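/- Let d ≥ 1, let α = (α_1,…,α_d) with 0 < α_i ≤ 1, let γ be a CRF and L the associated cone-like set. Then the maximal operator σ_L^{κ,α,*} is of type (p,p) for every 1 < p ≤ ∞, i.e. ‖σ_L^{κ,α,*} f‖_p ≤ c_p ‖f‖_p for f ∈ L_p(G^d), and it is of weak type (1,1): there is a constant c such that μ( { x ∈ G^d : σ_L^{κ,α,*} f(x) > λ } ) ≤ c ‖f‖_1 / λ for every f ∈ L^1(G^d) and λ > 0. -/

import Mathlib

open MeasureTheory Filter Finset ENNReal

noncomputable section

/-- The Walsh group `G`: countable product of copies of `ℤ/2ℤ`. -/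
abbrev WG : Type := ℕ → ZMod 2

/-- The normalized Haar measure (= product of uniform coin-toss measures) on `G`. -/
def μW : Measure WG := Measure.addHaarMeasure ⊤

instance : (μW).Regular := by unfold μW; infer_instance

instance : IsFiniteMeasure μW := by
  constructor
  rw [← TopologicalSpace.PositiveCompacts.coe_top (α := WG)]
  exact IsCompact.measure_lt_top (⊤ : TopologicalSpace.PositiveCompacts WG).isCompact

/-- The product measure on `G^d`. -/
def μD (d : ℕ) : Measure (Fin d → WG) := Measure.pi fun _ => μW

/-- The `k`-th Rademacher function. -/
def rad (k : ℕ) (x : WG) : ℝ := (-1 : ℝ) ^ (x k).val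

/-- The Walsh–Paley function of index `n`. -/
def walsh (n : ℕ) (x : WG) : ℝ :=
  ∏ k ∈ Finset.range n.size, if n.testBit k then rad k x else 1

/-- The Walsh–Kaczmarz function of index `n`; `Nat.log 2 n` is the order `|n|`. -/
def kacz (n : ℕ) (x : WG) : ℝ :=
  if n = 0 then 1 else
    rad (Nat.log 2 n) x *
      (-1 : ℝ) ^ (∑ k ∈ Finset.range (Nat.log 2 n),
        (if n.testBit k then 1 else 0) * (x (Nat.log 2 n - 1 - k)).val)

/-- The `d`-dimensional Walsh–Kaczmarz function. -/
def kaczD (d : ℕ) (m : Fin d → ℕ) (x : Fin d → WG) : ℝ := ∏ i, kacz (m i) (x i)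

/-- Walsh–Paley Dirichlet kernel. -/
def dirW (n : ℕ) (x : WG) : ℝ := ∑ k ∈ Finset.range n, walsh k x

/-- Walsh–Kaczmarz Dirichlet kernel. -/
def dirK (n : ℕ) (x : WG) : ℝ := ∑ k ∈ Finset.range n, kacz k x

/-- `A_j^α = binom (j+α) j`. -/
def Abin (α : ℝ) (j : ℕ) : ℝ := ∏ i ∈ Finset.range j, (α + i + 1) / (i + 1)

/-- One-dimensional Walsh–Paley `(C,α)` kernel. -/
def KW (α : ℝ) (n : ℕ) (x : WG) : ℝ :=
  (Abin α n)⁻¹ * ∑ k ∈ Finset.range (n + 1), Abin (α - 1) (n - k) * dirW k x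

/-- One-dimensional Walsh–Kaczmarz `(C,α)` kernel. -/
def KK (α : ℝ) (n : ℕ) (x : WG) : ℝ :=
  (Abin α n)⁻¹ * ∑ k ∈ Finset.range (n + 1), Abin (α - 1) (n - k) * dirK k x

/-- The `m`-th Walsh–Kaczmarz–Fourier coefficient of `f : G^d → ℝ`. -/
def fCoeff (d : ℕ) (f : (Fin d → WG) → ℝ) (m : Fin d → ℕ) : ℝ :=
  ∫ x, f x * kaczD d m x ∂ μD d

/-- Rectangular partial sum built from an abstract family `c` of Fourier coefficients. -/
def partialSumOf (d : ℕ) (c : (Fin d → ℕ) → ℝ) (k : Fin d → ℕ) (x : Fin d → WG) : ℝ :=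
  ∑ m ∈ Fintype.piFinset (fun i => Finset.range (k i)), c m * kaczD d m x

/-- `(C,α)` (Cesàro) mean of order `n` built from coefficients `c`. -/
def cesaroOf (d : ℕ) (α : Fin d → ℝ) (c : (Fin d → ℕ) → ℝ) (n : Fin d → ℕ)
    (x : Fin d → WG) : ℝ :=
  (∏ i, Abin (α i) (n i))⁻¹ *
    ∑ k ∈ Fintype.piFinset (fun i => Finset.range (n i + 1)),
      (∏ i, Abin (α i - 1) (n i - k i)) * partialSumOf d c k x

/-- A cone-like restriction function (CRF) family `γ = (γ_j)_{j ≠ 0}`. -/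
structure IsCRF (d : ℕ) [NeZero d] (γ : Fin d → ℝ → ℝ) : Prop where
  strictMono : ∀ j : Fin d, j ≠ 0 → StrictMonoOn (γ j) (Set.Ici 1)
  contOn : ∀ j : Fin d, j ≠ 0 → ContinuousOn (γ j) (Set.Ici 1)
  one_le : ∀ j : Fin d, j ≠ 0 → ∀ x : ℝ, 1 ≤ x → 1 ≤ γ j x
  map_one : ∀ j : Fin d, j ≠ 0 → γ j 1 = 1
  tendsto_atTop : ∀ j : Fin d, j ≠ 0 → Tendsto (γ j) atTop atTop
  reg : ∃ ζ : ℝ, 1 < ζ ∧ ∀ j : Fin d, j ≠ 0 → ∃ c₁ c₂ : ℝ, 1 < c₁ ∧ 1 < c₂ ∧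
    ∀ x : ℝ, 1 ≤ x → c₁ * γ j x ≤ γ j (ζ * x) ∧ γ j (ζ * x) ≤ c₂ * γ j x

/-- The cone-like set `L` determined by `γ` and the parameters `β`. -/
def coneLike (d : ℕ) [NeZero d] (γ : Fin d → ℝ → ℝ) (β : Fin d → ℝ) : Set (Fin d → ℕ) :=
  {n | ∀ j : Fin d, j ≠ 0 → (β j)⁻¹ * γ j (n 0) ≤ (n j : ℝ) ∧ (n j : ℝ) ≤ β j * γ j (n 0)}

/-- `bar γ n₁ = (n₁, n₂, …, n_d)` where `n_j = |γ_j(2^{n₁})|` is the order of `γ_j(2^{n₁})`,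
i.e. `2^{n_j} ≤ γ_j(2^{n₁}) < 2^{n_j+1}`. -/
def bar (d : ℕ) [NeZero d] (γ : Fin d → ℝ → ℝ) (n₁ : ℕ) : Fin d → ℕ :=
  fun j => if j = 0 then n₁ else Nat.log 2 ⌊γ j ((2 : ℝ) ^ n₁)⌋₊

/-- The cone-like restricted maximal operator `σ_L^{κ,α,*}` (built from coefficients `c`). -/
def cesaroMaximal (d : ℕ) [NeZero d] (α : Fin d → ℝ) (γ : Fin d → ℝ → ℝ) (β : Fin d → ℝ)
    (c : (Fin d → ℕ) → ℝ) (x : Fin d → WG) : ℝ≥0∞ :=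
  ⨆ n ∈ coneLike d γ β, ENNReal.ofReal |cesaroOf d α c n x|

/-- `L^p`-"norm" (`0 < p < ∞`) of an `ℝ≥0∞`-valued function on `G^d`. -/
def lpNormE (d : ℕ) (p : ℝ) (g : (Fin d → WG) → ℝ≥0∞) : ℝ≥0∞ :=
  (∫⁻ x, g x ^ p ∂ μD d) ^ (1 / p)

/-- The dyadic rectangle `I_{N}(y) = I_{N_1}(y^1) × ⋯ × I_{N_d}(y^d)`. -/
def rectAt (d : ℕ) (N : Fin d → ℕ) (y : Fin d → WG) : Set (Fin d → WG) :=
  {x | ∀ j : Fin d, ∀ i : ℕ, i < N j → x j i = y j i}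

/-- The one-dimensional dyadic interval `I_N = I_N(0)`. -/
def rectW (N : ℕ) : Set WG := {x | ∀ i : ℕ, i < N → x i = 0}

/-- A one-parameter martingale with respect to the filtration
`(F_{bar γ n₁})_{n₁}` generated by the dyadic rectangles `I_{bar γ n₁}(y)`
(measurability w.r.t. this atomic σ-algebra = being constant on its rectangles,
and the martingale property = equality of integrals over the rectangles). -/
structure ConeMartingale (d : ℕ) [NeZero d] (γ : Fin d → ℝ → ℝ) where
  F : ℕ → (Fin d → WG) → ℝ
  integrable : ∀ n₁, Integrable (F n₁) (μD d)
  adapted : ∀ n₁ (x y : Fin d → WG),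
    (∀ j : Fin d, ∀ i : ℕ, i < bar d γ n₁ j → x j i = y j i) → F n₁ x = F n₁ y
  mart : ∀ n₁ m₁, n₁ ≤ m₁ → ∀ y,
    ∫ x in rectAt d (bar d γ n₁) y, F m₁ x ∂ μD d
      = ∫ x in rectAt d (bar d γ n₁) y, F n₁ x ∂ μD d

/-- The Fourier coefficients of a martingale (the integrals `∫ f_k ψ_m` stabilize). -/
def martCoeff (d : ℕ) [NeZero d] (γ : Fin d → ℝ → ℝ) (f : ConeMartingale d γ) (m : Fin d → ℕ) : ℝ :=
  limUnder atTop (fun k => ∫ x, f.F k x * kaczD d m x ∂ μD d)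

/-- The maximal function `f* = sup_{n₁} |f_{bar n₁}|` of a martingale. -/
def martMaximal (d : ℕ) [NeZero d] (γ : Fin d → ℝ → ℝ) (f : ConeMartingale d γ)
    (x : Fin d → WG) : ℝ≥0∞ :=
  ⨆ n₁ : ℕ, ENNReal.ofReal |f.F n₁ x|

/-- The martingale Hardy space "norm" `‖f‖_{H_p^γ} = ‖f*‖_p`. -/
def hardyNorm (d : ℕ) [NeZero d] (γ : Fin d → ℝ → ℝ) (p : ℝ) (f : ConeMartingale d γ) : ℝ≥0∞ :=
  lpNormE d p (martMaximal d γ f)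

/-- A `p`-atom supported on the rectangle `I_N(y)`. -/
structure IsPAtom (d : ℕ) (p : ℝ) (a : (Fin d → WG) → ℝ) (N : Fin d → ℕ)
    (y : Fin d → WG) : Prop where
  measurable : Measurable a
  support : ∀ x, x ∉ rectAt d N y → a x = 0
  bound : ∀ x, |a x| ≤ ((μD d (rectAt d N y)).toReal) ^ (-(1 / p))
  zero : ∫ x, a x ∂ μD d = 0

/-- The conditional-expectation (dyadic average) of `f` at level `N`. -/
def avgAt (d : ℕ) (N : Fin d → ℕ) (f : (Fin d → WG) → ℝ) (x : Fin d → WG) : ℝ :=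
  (2 : ℝ) ^ (∑ j, N j) * ∫ t in rectAt d N x, f t ∂ μD d

/-- `m` is the martingale generated by the integrable function `f`. -/
def inducedLevels (d : ℕ) [NeZero d] (γ : Fin d → ℝ → ℝ) (f : (Fin d → WG) → ℝ)
    (m : ConeMartingale d γ) : Prop :=
  ∀ n₁ x, m.F n₁ x = avgAt d (bar d γ n₁) f x

/-- The martingale maximal function of (the martingale generated by) a function `f`,
`f* = sup_{n₁} |S_{2^{bar γ n₁}} f|`. -/
def funMaximal (d : ℕ) [NeZero d] (γ : Fin d → ℝ → ℝ) (f : (Fin d → WG) → ℝ)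
    (x : Fin d → WG) : ℝ≥0∞ :=
  ⨆ n₁ : ℕ, ENNReal.ofReal |partialSumOf d (fCoeff d f) (fun j => 2 ^ bar d γ n₁ j) x|

/-- The Hardy norm `‖f‖_{H_p^γ}` of (the martingale generated by) a function `f`. -/
def funHardyNorm (d : ℕ) [NeZero d] (γ : Fin d → ℝ → ℝ) (p : ℝ) (f : (Fin d → WG) → ℝ) : ℝ≥0∞ :=
  lpNormE d p (funMaximal d γ f)

/-- Skvortsov's bit-reversal transformation `τ_A`. -/
def tau (A : ℕ) (x : WG) : WG := fun i => if i < A then x (A - 1 - i) else x i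

end

/-- The sum `∑_{l < 2^B} c (N - l) χ_l`, where `χ_l` is the product of the signs `ε i` over the
binary digits of `l`, organised by the leading digit of `l`. -/
noncomputable def signSum (c ε : ℕ → ℝ) : ℕ → ℕ → ℝ
  | 0, N => c N
  | B + 1, N => signSum c ε B N + ε B * signSum c ε B (N - 2 ^ B)

/-- Concavity of a sequence which vanishes at `0` and is monotone. -/
structure IsConcaveSeq (c : ℕ → ℝ) : Prop where
  zero : c 0 = 0
  mono : Monotone c
  incr : ∀ h M N, M ≤ N → c (N + h) - c N ≤ c (M + h) - c M

section signSum

variable {c ε : ℕ → ℝ}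

lemma IsConcaveSeq.nonneg (hc : IsConcaveSeq c) (N : ℕ) : 0 ≤ c N :=
  hc.zero ▸ hc.mono (Nat.zero_le N)

lemma signSum_le_of_one (hc : IsConcaveSeq c) {B : ℕ} (hε : ∀ i < B, ε i = 1) (N : ℕ) :
    0 ≤ signSum c ε B N ∧ signSum c ε B N ≤ 2 ^ B * c N := by
  induction B generalizing N with
  | zero => simp [signSum, hc.nonneg]
  | succ B ih =>
    have h1 := ih (fun i hi => hε i (by omega)) N
    have h2 := ih (fun i hi => hε i (by omega)) (N - 2 ^ B)
    have h3 : c (N - 2 ^ B) ≤ c N := hc.mono (Nat.sub_le _ _)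
    have h4 : (2 : ℝ) ^ B * c (N - 2 ^ B) ≤ 2 ^ B * c N := by gcongr
    simp only [signSum, hε B (by omega), one_mul]
    constructor
    · linarith
    · rw [pow_succ]; linarith

lemma le_signSum_of_one (hc : IsConcaveSeq c) {B : ℕ} (hε : ∀ i < B, ε i = 1) (N : ℕ) :
    2 ^ B * c (N - 2 ^ B) ≤ signSum c ε B N := by
  induction B generalizing N with
  | zero => simpa [signSum] using hc.mono (Nat.sub_le N 1)
  | succ B ih =>
    have h1 := ih (fun i hi => hε i (by omega)) N
    have h2 := ih (fun i hi => hε i (by omega)) (N - 2 ^ B)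
    have e : N - 2 ^ B - 2 ^ B = N - 2 ^ (B + 1) := by rw [pow_succ]; omega
    have h3 : c (N - 2 ^ (B + 1)) ≤ c (N - 2 ^ B) := hc.mono (by rw [pow_succ]; omega)
    have h4 : (2 : ℝ) ^ B * c (N - 2 ^ (B + 1)) ≤ 2 ^ B * c (N - 2 ^ B) := by gcongr
    rw [e] at h2
    simp only [signSum, hε B (by omega), one_mul]
    have e2 : (2 : ℝ) ^ (B + 1) * c (N - 2 ^ (B + 1))
      = 2 ^ B * c (N - 2 ^ (B + 1)) + 2 ^ B * c (N - 2 ^ (B + 1)) := by ring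
    linarith

lemma signSum_incr_of_one (hc : IsConcaveSeq c) {B : ℕ} (hε : ∀ i < B, ε i = 1)
    (h M N : ℕ) (hM : 2 ^ B ≤ M) (hMN : M ≤ N) :
    signSum c ε B (N + h) - signSum c ε B N ≤ signSum c ε B (M + h) - signSum c ε B M := by
  induction B generalizing M N with
  | zero => simpa [signSum] using hc.incr h M N hMN
  | succ B ih =>
    rw [pow_succ] at hM
    have h1 := ih (fun i hi => hε i (by omega)) M N (by omega) hMN
    have h2 := ih (fun i hi => hε i (by omega)) (M - 2 ^ B) (N - 2 ^ B) (by omega) (by omega)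
    simp only [signSum, hε B (by omega), one_mul]
    rw [show N + h - 2 ^ B = N - 2 ^ B + h by omega, show M + h - 2 ^ B = M - 2 ^ B + h by omega]
    linarith

/-- One negative sign produces a nonnegative antitone sum. -/
lemma signSum_of_single (hc : IsConcaveSeq c) {k B : ℕ} (hkB : k < B)
    (hk : ε k = -1) (hε : ∀ i < B, i ≠ k → ε i = 1) :
    (∀ N, 2 ^ B ≤ N → 0 ≤ signSum c ε B N ∧
      signSum c ε B N ≤ 2 ^ k * (c N - c (N - 2 ^ B))) ∧
    (∀ M N, 2 ^ B ≤ M → M ≤ N → signSum c ε B N ≤ signSum c ε B M) := by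
  induction B, hkB using Nat.le_induction with
  | base =>
    have hε' : ∀ i < k, ε i = 1 := fun i hi => hε i (by omega) (by omega)
    have e : ∀ N, N - 2 ^ (k + 1) = N - 2 ^ k - 2 ^ k := fun N => by rw [pow_succ]; omega
    have anti : ∀ M N, 2 ^ (k + 1) ≤ M → M ≤ N →
        signSum c ε (k + 1) N ≤ signSum c ε (k + 1) M := by
      intro M N hM hMN
      rw [pow_succ] at hM
      have := signSum_incr_of_one hc hε' (2 ^ k) (M - 2 ^ k) (N - 2 ^ k) (by omega) (by omega)
      rw [Nat.sub_add_cancel (by omega), Nat.sub_add_cancel (by omega)] at this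
      simp only [signSum, hk]
      linarith
    refine ⟨fun N hN => ⟨?_, ?_⟩, anti⟩
    · have mono : ∀ {j : ℕ}, (∀ i < j, ε i = 1) → Monotone (signSum c ε j) := by
        intro j
        induction j with
        | zero => intro _; exact hc.mono
        | succ j ih =>
          intro hj M N hMN
          have := ih (fun i hi => hj i (by omega)) hMN
          have := ih (fun i hi => hj i (by omega)) (Nat.sub_le_sub_right hMN (2 ^ j))
          simp only [signSum, hj j (by omega), one_mul]
          linarith
      have := mono hε' (Nat.sub_le N (2 ^ k))
      simp only [signSum, hk]
      linarith
    · have h1 := (signSum_le_of_one hc hε' N).2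
      have h2 := le_signSum_of_one hc hε' (N - 2 ^ k)
      rw [e]
      simp only [signSum, hk]
      linarith
  | succ B hB ih =>
    obtain ⟨ih1, ih2⟩ := ih (fun i hi => hε i (by omega))
    have e : ∀ N, N - 2 ^ (B + 1) = N - 2 ^ B - 2 ^ B := fun N => by rw [pow_succ]; omega
    have e1 : ε B = 1 := hε B (by omega) (by omega)
    constructor
    · intro N hN
      rw [pow_succ] at hN
      have h1 := ih1 N (by omega)
      have h2 := ih1 (N - 2 ^ B) (by omega)
      rw [e]
      simp only [signSum, e1]
      constructor <;> linarith
    · intro M N hM hMN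
      rw [pow_succ] at hM
      have h1 := ih2 M N (by omega) hMN
      have h2 := ih2 (M - 2 ^ B) (N - 2 ^ B) (by omega) (by omega)
      simp only [signSum, e1]
      linarith

/-- The bound determined by the two lowest negative signs. -/
lemma abs_signSum_le (hc : IsConcaveSeq c) (hε1 : ∀ i, |ε i| = 1) {k k' B : ℕ}
    (hk' : k < k') (hB : k' ≤ B) (hk : ε k = -1) (hε : ∀ i < k', i ≠ k → ε i = 1)
    (hneg : k' = B ∨ ε k' = -1) (N : ℕ) (hN : 2 ^ B ≤ N) :
    |signSum c ε B N| ≤ 2 ^ k * c (2 ^ k') := by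
  obtain ⟨h1, h2⟩ := signSum_of_single hc hk' hk hε
  have h3 : signSum c ε k' (2 ^ k') ≤ 2 ^ k * c (2 ^ k') := by
    simpa [hc.zero] using (h1 (2 ^ k') le_rfl).2
  rcases hB.eq_or_lt with rfl | hlt
  · rw [abs_of_nonneg (h1 N hN).1]
    exact (h2 _ _ le_rfl hN).trans h3
  · have hneg' : ε k' = -1 := hneg.resolve_left hlt.ne
    have key : ∀ N, 2 ^ B ≤ N → |signSum c ε B N| ≤
        signSum c ε k' (N - 2 ^ B + 2 ^ k') - signSum c ε k' N := by
      clear hN hneg N hB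
      induction B, hlt using Nat.le_induction with
      | base =>
        intro N hN
        rw [pow_succ] at hN
        have e : N - 2 ^ (k' + 1) + 2 ^ k' = N - 2 ^ k' := by rw [pow_succ]; omega
        have := h2 (N - 2 ^ k') N (by omega) (by omega)
        rw [e]
        simp only [signSum, hneg']
        rw [abs_of_nonpos (by linarith)]
        linarith
      | succ B hB ih =>
        intro N hN
        rw [pow_succ] at hN
        have hp : 2 ^ k' ≤ 2 ^ B := Nat.pow_le_pow_right (by norm_num) (by omega)
        have i1 := ih N (by omega)
        have i2 := ih (N - 2 ^ B) (by omega)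
        have i3 := h2 (N - 2 ^ B) (N - 2 ^ B + 2 ^ k') (by omega) (Nat.le_add_right _ _)
        have e : N - 2 ^ (B + 1) + 2 ^ k' = N - 2 ^ B - 2 ^ B + 2 ^ k' := by rw [pow_succ]; omega
        rw [e]
        simp only [signSum]
        have i4 := abs_add_le (signSum c ε B N) (ε B * signSum c ε B (N - 2 ^ B))
        rw [abs_mul, hε1, one_mul] at i4
        linarith
    have a1 := key N hN
    have hp : 2 ^ k' ≤ 2 ^ B := Nat.pow_le_pow_right (by norm_num) (by omega)
    have a2 := (h1 N (hp.trans hN)).1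
    have a3 := h2 (2 ^ k') (N - 2 ^ B + 2 ^ k') le_rfl (by omega)
    linarith

end signSum

/-- The product of the signs `ε i` over the binary digits of `l`. -/
noncomputable def digitSign (ε : ℕ → ℝ) (l : ℕ) : ℝ :=
  ∏ i ∈ range l, if l.testBit i then ε i else 1

lemma digitSign_eq (ε : ℕ → ℝ) {l L : ℕ} (h : l < 2 ^ L) :
    digitSign ε l = ∏ i ∈ range L, if l.testBit i then ε i else 1 := by
  have key : ∀ K, l < 2 ^ K → ∏ i ∈ range K, (if l.testBit i then ε i else 1)
      = ∏ i ∈ range (max K L), if l.testBit i then ε i else 1 := by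
    intro K hK
    apply prod_subset (range_subset_range.2 (le_max_left _ _))
    intro i _ hi
    rw [mem_range, not_lt] at hi
    rw [Nat.testBit_lt_two_pow (hK.trans_le (Nat.pow_le_pow_right (by norm_num) hi))]
    simp
  have key2 : ∀ K, L ≤ K → ∏ i ∈ range L, (if l.testBit i then ε i else 1)
      = ∏ i ∈ range K, if l.testBit i then ε i else 1 := by
    intro K hK
    apply prod_subset (range_subset_range.2 hK)
    intro i _ hi
    rw [mem_range, not_lt] at hi
    rw [Nat.testBit_lt_two_pow (h.trans_le (Nat.pow_le_pow_right (by norm_num) hi))]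
    simp
  rw [digitSign, key l Nat.lt_two_pow_self, key2 _ (le_max_right l L)]

lemma digitSign_two_pow_add (ε : ℕ → ℝ) {l b : ℕ} (h : l < 2 ^ b) :
    digitSign ε (2 ^ b + l) = ε b * digitSign ε l := by
  rw [digitSign_eq ε (show 2 ^ b + l < 2 ^ (b + 1) by rw [pow_succ]; omega), digitSign_eq ε h,
    prod_range_succ, mul_comm]
  congr 1
  · rw [Nat.testBit_two_pow_add_eq, Nat.testBit_lt_two_pow h]; simp
  · apply prod_congr rfl
    intro i hi
    rw [Nat.testBit_two_pow_add_gt (mem_range.1 hi)]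

lemma sum_digitSign_two_pow (c ε : ℕ → ℝ) (B N : ℕ) :
    ∑ l ∈ range (2 ^ B), c (N - l) * digitSign ε l = signSum c ε B N := by
  induction B generalizing N with
  | zero => simp [signSum, digitSign]
  | succ B ih =>
    rw [show 2 ^ (B + 1) = 2 ^ B + 2 ^ B by rw [pow_succ]; omega, sum_range_add, signSum,
      ← ih, ← ih, mul_sum]
    congr 1
    apply sum_congr rfl
    intro l hl
    rw [digitSign_two_pow_add ε (mem_range.1 hl), Nat.sub_sub]
    ring

/-- A full Cesàro-type sum is bounded by the sum of its dyadic pieces. -/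
lemma abs_sum_digitSign_le {c ε : ℕ → ℝ} (hε1 : ∀ i, |ε i| = 1) {U : ℕ → ℝ} {A : ℕ}
    (hU0 : ∀ b, 0 ≤ U b)
    (hU : ∀ b < A, ∀ N, 2 ^ b ≤ N → N < 2 ^ (b + 1) → |signSum c ε b N| ≤ U b)
    (m : ℕ) (hm : m < 2 ^ A) :
    |∑ l ∈ range m, c (m - l) * digitSign ε l| ≤ ∑ b ∈ range A, U b := by
  induction A generalizing m with
  | zero => simp [show m = 0 by simpa using hm]
  | succ A ih =>
    rw [sum_range_succ]
    have ih' := ih (fun b hb => hU b (by omega))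
    by_cases h : m < 2 ^ A
    · have := ih' m h
      have := hU0 A
      linarith
    · obtain ⟨q, rfl⟩ := Nat.exists_eq_add_of_le (not_lt.1 h)
      rw [pow_succ] at hm
      rw [sum_range_add, sum_digitSign_two_pow]
      have e : ∑ l ∈ range q, c (2 ^ A + q - (2 ^ A + l)) * digitSign ε (2 ^ A + l)
          = ε A * ∑ l ∈ range q, c (q - l) * digitSign ε l := by
        rw [mul_sum]
        apply sum_congr rfl
        intro l hl
        rw [digitSign_two_pow_add ε (by have := mem_range.1 hl; omega), Nat.add_sub_add_left]
        ring
      rw [e]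
      have h1 := ih' q (by omega)
      have h2 := hU A (by omega) (2 ^ A + q) (by omega) (by rw [pow_succ]; omega)
      have h3 := abs_add_le (signSum c ε A (2 ^ A + q))
        (ε A * ∑ l ∈ range q, c (q - l) * digitSign ε l)
      rw [abs_mul, hε1, one_mul] at h3
      linarith

section Cesaro

/-- Partial sums of the Cesàro numbers of order `α - 1`. -/
noncomputable def cSum (α : ℝ) (N : ℕ) : ℝ := ∑ j ∈ range N, Abin (α - 1) j

lemma Abin_succ (α : ℝ) (n : ℕ) : Abin α (n + 1) = Abin α n * ((α + n + 1) / (n + 1)) := by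
  rw [Abin, Abin, prod_range_succ]

lemma Abin_sub_one_succ (α : ℝ) (n : ℕ) : Abin (α - 1) (n + 1) = α / (n + 1) * Abin α n := by
  induction n with
  | zero => simp [Abin]
  | succ n ih =>
    rw [Abin_succ, ih, Abin_succ]
    push_cast
    field_simp
    ring

lemma Abin_eq_cSum (α : ℝ) (n : ℕ) : Abin α n = cSum α (n + 1) := by
  induction n with
  | zero => simp [Abin, cSum]
  | succ n ih =>
    rw [cSum, sum_range_succ, ← cSum, ← ih, Abin_sub_one_succ, Abin_succ]
    field_simp
    ring

lemma cast_mul_Abin_sub_one (α : ℝ) (n : ℕ) : n * Abin (α - 1) n = α * cSum α n := by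
  cases n with
  | zero => simp [cSum]
  | succ n =>
    rw [Abin_sub_one_succ, Abin_eq_cSum]
    push_cast
    field_simp

variable {α : ℝ}

lemma Abin_sub_one_pos (h0 : 0 < α) (n : ℕ) : 0 < Abin (α - 1) n := by
  apply prod_pos
  intro i _
  apply div_pos <;> linarith [(Nat.cast_nonneg i : (0 : ℝ) ≤ i)]

lemma Abin_sub_one_antitone (h0 : 0 < α) (h1 : α ≤ 1) : Antitone (Abin (α - 1)) := by
  apply antitone_nat_of_succ_le
  intro n
  rw [Abin_succ]
  apply mul_le_of_le_one_right (Abin_sub_one_pos h0 n).le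
  rw [div_le_one (by positivity)]
  linarith

lemma isConcaveSeq_cSum (h0 : 0 < α) (h1 : α ≤ 1) : IsConcaveSeq (cSum α) where
  zero := by simp [cSum]
  mono := monotone_nat_of_le_succ fun n => by
    rw [cSum, cSum, sum_range_succ]
    linarith [Abin_sub_one_pos h0 n]
  incr h M N hMN := by
    simp only [cSum, sum_range_add, add_sub_cancel_left]
    exact sum_le_sum fun j _ => Abin_sub_one_antitone h0 h1 (by omega)

lemma cSum_pos (h0 : 0 < α) {N : ℕ} (hN : 0 < N) : 0 < cSum α N :=
  sum_pos (fun j _ => Abin_sub_one_pos h0 j) (by simpa using hN.ne')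

lemma cSum_two_mul (h0 : 0 < α) (h1 : α ≤ 1) (m : ℕ) :
    (1 + α / 2) * cSum α m ≤ cSum α (2 * m) := by
  rcases Nat.eq_zero_or_pos m with rfl | hm
  · simp [cSum]
  have hb : (m : ℝ) * Abin (α - 1) (2 * m) ≤ ∑ j ∈ range m, Abin (α - 1) (m + j) := by
    rw [← nsmul_eq_mul, ← card_range m, ← sum_const, card_range]
    exact sum_le_sum fun j hj => Abin_sub_one_antitone h0 h1 (by have := mem_range.1 hj; omega)
  have h2 := cast_mul_Abin_sub_one α (2 * m)
  push_cast at h2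
  have h3 : cSum α (2 * m) = cSum α m + ∑ j ∈ range m, Abin (α - 1) (m + j) := by
    rw [two_mul, cSum, cSum, sum_range_add]
  have h4 : cSum α m ≤ cSum α (2 * m) := (isConcaveSeq_cSum h0 h1).mono (by omega)
  nlinarith

lemma cSum_two_pow_le (h0 : 0 < α) (h1 : α ≤ 1) {j A : ℕ} (h : j ≤ A) :
    cSum α (2 ^ j) ≤ ((1 + α / 2)⁻¹) ^ (A - j) * cSum α (2 ^ A) := by
  induction A, h using Nat.le_induction with
  | base => simp
  | succ A hA ih =>
    refine ih.trans ?_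
    rw [Nat.sub_add_comm hA, pow_succ, mul_assoc]
    gcongr
    rw [inv_mul_eq_div, le_div_iff₀ (by linarith), mul_comm]
    have := cSum_two_mul h0 h1 (2 ^ A)
    rwa [← pow_succ'] at this

lemma KK_eq (α : ℝ) (n : ℕ) (x : WG) :
    KK α n x = (Abin α n)⁻¹ * ∑ m ∈ range n, cSum α (n - m) * kacz m x := by
  have h1 : ∀ k ∈ range (n + 1), Abin (α - 1) (n - k) * dirK k x
      = ∑ m ∈ range n, if m < k then Abin (α - 1) (n - k) * kacz m x else 0 := by
    intro k hk
    rw [dirK, mul_sum, ← sum_filter]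
    apply sum_congr _ fun _ _ => rfl
    ext m
    have := mem_range.1 hk
    simp only [mem_range, mem_filter]
    omega
  rw [KK, sum_congr rfl h1, sum_comm]
  congr 1
  apply sum_congr rfl
  intro m hm
  rw [← sum_flip (fun k => if m < k then Abin (α - 1) (n - k) * kacz m x else 0), cSum, sum_mul,
    ← sum_filter]
  have hm' := mem_range.1 hm
  apply sum_congr
  · ext j
    simp only [mem_range, mem_filter]
    omega
  · intro j hj
    rw [Nat.sub_sub_self]
    have := mem_range.1 hj
    omega

end Cesaro

section Kaczmarz

lemma zmod_two_cases (a : ZMod 2) : a = 0 ∨ a = 1 := by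
  revert a
  decide

lemma abs_rad (k : ℕ) (x : WG) : |rad k x| = 1 := by simp [rad]

lemma rad_eq (k : ℕ) (x : WG) : rad k x = if x k = 0 then 1 else -1 := by
  rcases zmod_two_cases (x k) with h | h <;> simp [rad, h, ZMod.val_one]

lemma rad_add (k : ℕ) (x y : WG) : rad k (x + y) = rad k x * rad k y := by
  have h2 : (1 : ZMod 2) + 1 = 0 := by decide
  rcases zmod_two_cases (x k) with h | h <;> rcases zmod_two_cases (y k) with h' | h' <;>
    simp [rad_eq, h, h', h2]

lemma kacz_eq {A l : ℕ} (hl : l < 2 ^ A) (x : WG) :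
    kacz (2 ^ A + l) x = rad A x * digitSign (fun i => rad (A - 1 - i) x) l := by
  have hlog : Nat.log 2 (2 ^ A + l) = A :=
    Nat.log_eq_of_pow_le_of_lt_pow (by omega) (by rw [pow_succ]; omega)
  have hne : 2 ^ A + l ≠ 0 := by have := Nat.two_pow_pos A; omega
  rw [kacz, if_neg hne, hlog, digitSign_eq _ hl, ← prod_pow_eq_pow_sum]
  congr 1
  apply prod_congr rfl
  intro i hi
  rw [Nat.testBit_two_pow_add_gt (mem_range.1 hi)]
  split_ifs <;> simp [rad]

lemma kacz_add (n : ℕ) (x y : WG) : kacz n (x + y) = kacz n x * kacz n y := by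
  rcases eq_or_ne n 0 with rfl | hn
  · simp [kacz]
  have h1 := Nat.pow_log_le_self 2 hn
  have h2 := Nat.lt_pow_succ_log_self (b := 2) (by norm_num) n
  rw [pow_succ] at h2
  obtain ⟨l, hl⟩ := Nat.exists_eq_add_of_le h1
  have hl' : l < 2 ^ Nat.log 2 n := by omega
  rw [hl, kacz_eq hl', kacz_eq hl', kacz_eq hl', rad_add]
  have : digitSign (fun i => rad (Nat.log 2 n - 1 - i) (x + y)) l
      = digitSign (fun i => rad (Nat.log 2 n - 1 - i) x) l
        * digitSign (fun i => rad (Nat.log 2 n - 1 - i) y) l := by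
    simp only [digitSign, ← prod_mul_distrib, rad_add]
    apply prod_congr rfl
    intro i _
    split_ifs <;> simp
  rw [this]
  ring

lemma kacz_eq_one {B m : ℕ} (hm : m < 2 ^ B) {x : WG} (hx : ∀ i < B, x i = 0) :
    kacz m x = 1 := by
  rcases eq_or_ne m 0 with rfl | hn
  · simp [kacz]
  have hlog : Nat.log 2 m < B := Nat.log_lt_of_lt_pow hn hm
  rw [kacz, if_neg hn, rad_eq, hx _ hlog, sum_eq_zero]
  · simp
  · intro k hk
    have := mem_range.1 hk
    rw [hx _ (by omega)]
    simp

lemma abs_kacz (n : ℕ) (x : WG) : |kacz n x| = 1 := by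
  unfold kacz
  split_ifs <;> simp [abs_mul, abs_rad]

end Kaczmarz

section KernelBound

lemma digitSign_eq_one {ε : ℕ → ℝ} {B l : ℕ} (hl : l < 2 ^ B) (hε : ∀ i < B, ε i = 1) :
    digitSign ε l = 1 := by
  rw [digitSign_eq ε hl]
  apply prod_eq_one
  intro i hi
  rw [hε i (mem_range.1 hi), ite_self]

/-- The quadruples of parameters indexing the dyadic averaging kernels. -/
abbrev WinParam : Type := ℕ × ℕ × ℕ × ℕ

/-- The sum of the parameters. -/
def WinParam.size (p : WinParam) : ℕ := p.1 + p.2.1 + p.2.2.1 + p.2.2.2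

/-- The coordinates of `x` in the window `[r + t, A - s)` vanish, except for the one at
`r + t + u - 1`, which is `1` if it lies in the window; here `p = (r, s, t, u)`. -/
def InWin (A : ℕ) (p : WinParam) (x : WG) : Prop :=
  ∀ i, p.1 + p.2.2.1 ≤ i → i + p.2.1 < A →
    x i = if i + 1 = p.1 + p.2.2.1 + p.2.2.2 then 1 else 0

/-- The length of the window. -/
def winLen (A : ℕ) (p : WinParam) : ℕ := A - p.2.1 - (p.1 + p.2.2.1)

open Classical in
/-- The weighted normalized indicator function of a window. -/
noncomputable def winKer (θ : ℝ) (A : ℕ) (p : WinParam) (x : WG) : ℝ :=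
  θ ^ p.size * (if InWin A p x then 2 ^ winLen A p else 0)

lemma winKer_nonneg {θ : ℝ} (hθ : 0 ≤ θ) (A : ℕ) (p : WinParam) (x : WG) :
    0 ≤ winKer θ A p x := by
  unfold winKer
  positivity

lemma winKer_of_inWin {θ : ℝ} {A : ℕ} {p : WinParam} {x : WG} (h : InWin A p x) :
    winKer θ A p x = θ ^ p.size * 2 ^ winLen A p := by
  rw [winKer, if_pos h]

variable {c : ℕ → ℝ} {θ : ℝ}

lemma exists_two_lowest {b : ℕ} {ε : ℕ → ℝ} (hε : ∀ i, ε i = 1 ∨ ε i = -1)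
    (h : ∃ i < b, ε i = -1) :
    ∃ k k', k < k' ∧ k' ≤ b ∧ ε k = -1 ∧ (∀ i < k', i ≠ k → ε i = 1) ∧ (k' = b ∨ ε k' = -1) := by
  classical
  set k := Nat.find h with hk
  obtain ⟨hkb, hk1⟩ := Nat.find_spec h
  have hmin : ∀ i < k, ε i = 1 := fun i hi =>
    (hε i).resolve_right fun hi' => Nat.find_min h hi ⟨lt_trans hi hkb, hi'⟩
  have h' : ∃ i, k < i ∧ (i = b ∨ ε i = -1) := ⟨b, hkb, Or.inl rfl⟩
  obtain ⟨h1, h2⟩ := Nat.find_spec h'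
  refine ⟨k, Nat.find h', h1, Nat.find_min' h' ⟨hkb, Or.inl rfl⟩, hk1, ?_, h2⟩
  intro i hi hik
  rcases lt_or_gt_of_ne hik with h3 | h3
  · exact hmin i h3
  · exact (hε i).resolve_right fun hi' => Nat.find_min h' hi ⟨h3, Or.inr hi'⟩

lemma rad_cases (k : ℕ) (x : WG) : rad k x = 1 ∨ rad k x = -1 := by
  rw [rad_eq]; split_ifs <;> simp

lemma eq_zero_of_rad {k : ℕ} {x : WG} (h : rad k x = 1) : x k = 0 := by
  rw [rad_eq] at h
  by_contra h'
  rw [if_neg h'] at h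
  norm_num at h

lemma eq_one_of_rad {k : ℕ} {x : WG} (h : rad k x = -1) : x k = 1 := by
  rw [rad_eq] at h
  refine (zmod_two_cases (x k)).resolve_left fun h' => ?_
  rw [if_pos h'] at h
  norm_num at h

/-- The bound for one dyadic block, in terms of the pattern of the digits of `x`. -/
lemma exists_abs_signSum_le (hc : IsConcaveSeq c) {A b : ℕ} (hb : b ≤ A) (x : WG)
    (h : ∃ i < b, rad (A - 1 - i) x = -1) :
    ∃ t u, t + u ≤ b ∧
      (∀ j, A - b + t ≤ j → j < A → x j = if j + 1 = A - b + t + u then 1 else 0) ∧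
      ∀ N, 2 ^ b ≤ N → |signSum c (fun i => rad (A - 1 - i) x) b N|
        ≤ 2 ^ (b - t - u) * c (2 ^ (b - t)) := by
  obtain ⟨k, k', h1, h2, h3, h4, h5⟩ :=
    exists_two_lowest (fun i => rad_cases (A - 1 - i) x) h
  refine ⟨b - k', k' - k, by omega, ?_, ?_⟩
  · intro j hj hjA
    split_ifs with hjk
    · rw [show j = A - 1 - k by omega]
      exact eq_one_of_rad h3
    · have := eq_zero_of_rad (h4 (A - 1 - j) (by omega) (by omega))
      rwa [show A - 1 - (A - 1 - j) = j by omega] at this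
  · intro N hN
    have := abs_signSum_le hc (fun i => abs_rad (A - 1 - i) x) h1 h2 h3 h4 h5 N hN
    rwa [show b - (b - k') - (k' - k) = k by omega, show b - (b - k') = k' by omega]

lemma two_pow_sub_le (hθ : 1 / 2 ≤ θ) {m u : ℕ} (h : u ≤ m) :
    (2 : ℝ) ^ (m - u) ≤ θ ^ u * 2 ^ m := by
  obtain ⟨k, rfl⟩ := Nat.exists_eq_add_of_le h
  rw [Nat.add_sub_cancel_left, pow_add, ← mul_assoc, ← mul_pow]
  have : (1 : ℝ) ≤ (θ * 2) ^ u := one_le_pow₀ (by linarith)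
  have h2 : (0 : ℝ) < 2 ^ k := by positivity
  nlinarith

lemma sum_range_two_pow_split (f : ℕ → ℝ) {j A : ℕ} (h : j ≤ A) :
    ∑ m ∈ range (2 ^ A), f m = ∑ m ∈ range (2 ^ j), f m
      + ∑ B ∈ Ico j A, ∑ l ∈ range (2 ^ B), f (2 ^ B + l) := by
  induction A, h using Nat.le_induction with
  | base => simp
  | succ A hA ih =>
    rw [sum_Ico_succ_top hA, ← add_assoc, ← ih, show 2 ^ (A + 1) = 2 ^ A + 2 ^ A by
      rw [pow_succ]; omega, sum_range_add]

/-- The bound for one dyadic block of lower order. -/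
lemma lower_block_le (hc : IsConcaveSeq c) (hθ : 1 / 2 ≤ θ) {A : ℕ}
    (hdec : ∀ j ≤ A, c (2 ^ j) ≤ θ ^ (A - j) * c (2 ^ A)) {B : ℕ} (hB : B < A) (x : WG)
    (h : ∃ i < B, x i = 1) :
    ∃ t u, ∀ N, 2 ^ B ≤ N → |signSum c (fun i => rad (B - 1 - i) x) B N|
        ≤ c (2 ^ A) * winKer θ A (0, A - B, t, u) x := by
  obtain ⟨i, hi, hxi⟩ := h
  obtain ⟨t, u, h1, h2, h3⟩ := exists_abs_signSum_le hc (le_refl B) x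
    ⟨B - 1 - i, by omega, by
      rw [show B - 1 - (B - 1 - i) = i by omega, rad_eq, hxi, if_neg (by decide)]⟩
  refine ⟨t, u, fun N hN => (h3 N hN).trans ?_⟩
  rw [winKer_of_inWin]
  · simp only [WinParam.size, winLen]
    rw [show A - (A - B) - (0 + t) = B - t by omega,
      show 0 + (A - B) + t + u = u + (A - (B - t)) by omega, pow_add]
    have h4 := two_pow_sub_le hθ (show u ≤ B - t by omega)
    have h5 := hdec (B - t) (by omega)
    have h6 : 0 ≤ c (2 ^ (B - t)) := hc.nonneg _
    calc (2 : ℝ) ^ (B - t - u) * c (2 ^ (B - t))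
        ≤ (θ ^ u * 2 ^ (B - t)) * (θ ^ (A - (B - t)) * c (2 ^ A)) := by gcongr
      _ = _ := by ring
  · intro j hj hjA
    simp only at hj hjA ⊢
    rw [h2 j (by omega) (by omega)]
    congr 2
    omega

/-- The bound for one dyadic piece of the block of highest order. -/
lemma top_block_le (hc : IsConcaveSeq c) (hθ : 1 / 2 ≤ θ) {A : ℕ}
    (hdec : ∀ j ≤ A, c (2 ^ j) ≤ θ ^ (A - j) * c (2 ^ A)) {b : ℕ} (hb : b < A) (x : WG) :
    ∃ t u, ∀ N, 2 ^ b ≤ N → N < 2 ^ (b + 1) →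
      |signSum c (fun i => rad (A - 1 - i) x) b N|
        ≤ 2 * c (2 ^ A) * winKer θ A (A - b, 0, t, u) x := by
  have hcA : 0 ≤ c (2 ^ A) := hc.nonneg _
  by_cases h : ∃ i < b, rad (A - 1 - i) x = -1
  · obtain ⟨t, u, h1, h2, h3⟩ := exists_abs_signSum_le hc hb.le x h
    refine ⟨t, u, fun N hN _ => (h3 N hN).trans ?_⟩
    rw [winKer_of_inWin]
    · simp only [WinParam.size, winLen]
      rw [show A - 0 - (A - b + t) = b - t by omega,
        show A - b + 0 + t + u = u + (A - (b - t)) by omega, pow_add]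
      have h4 := two_pow_sub_le hθ (show u ≤ b - t by omega)
      have h5 := hdec (b - t) (by omega)
      have h6 : 0 ≤ c (2 ^ (b - t)) := hc.nonneg _
      have h7 : 0 ≤ (θ ^ u * 2 ^ (b - t)) * (θ ^ (A - (b - t)) * c (2 ^ A)) := by positivity
      calc (2 : ℝ) ^ (b - t - u) * c (2 ^ (b - t))
          ≤ (θ ^ u * 2 ^ (b - t)) * (θ ^ (A - (b - t)) * c (2 ^ A)) := by gcongr
        _ ≤ 2 * ((θ ^ u * 2 ^ (b - t)) * (θ ^ (A - (b - t)) * c (2 ^ A))) := by linarith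
        _ = _ := by ring
    · intro j hj hjA
      simp only at hj hjA ⊢
      rw [h2 j (by omega) (by omega)]
  · push Not at h
    have h' : ∀ i < b, rad (A - 1 - i) x = 1 := fun i hi =>
      (rad_cases _ x).resolve_right (h i hi)
    refine ⟨0, 0, fun N hN hN2 => ?_⟩
    obtain ⟨h1, h2⟩ := signSum_le_of_one hc h' N
    rw [abs_of_nonneg h1, winKer_of_inWin]
    · refine h2.trans ?_
      simp only [WinParam.size, winLen]
      rw [show A - 0 - (A - b + 0) = b by omega, show A - b + 0 + 0 + 0 = A - (b + 1) + 1 by omega,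
        pow_succ]
      have h5 := (hc.mono hN2.le).trans (hdec (b + 1) (by omega))
      have h6 : 0 ≤ θ ^ (A - (b + 1)) * c (2 ^ A) := by positivity
      calc (2 : ℝ) ^ b * c N ≤ 2 ^ b * (θ ^ (A - (b + 1)) * c (2 ^ A)) := by gcongr
        _ ≤ (2 * θ) * (2 ^ b * (θ ^ (A - (b + 1)) * c (2 ^ A))) :=
            le_mul_of_one_le_left (by positivity) (by linarith)
        _ = _ := by ring
    · intro j hj hjA
      simp only at hj hjA ⊢
      rw [if_neg (by omega)]
      have := eq_zero_of_rad (h' (A - 1 - j) (by omega))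
      rwa [show A - 1 - (A - 1 - j) = j by omega] at this

/-- The pointwise bound of the Walsh–Kaczmarz sums by dyadic averaging kernels. -/
lemma exists_abs_sum_kacz_le (hc : IsConcaveSeq c) (hθ : 1 / 2 ≤ θ) {A n : ℕ}
    (hdec : ∀ j ≤ A, c (2 ^ j) ≤ θ ^ (A - j) * c (2 ^ A)) (h1 : 2 ^ A ≤ n)
    (h2 : n < 2 ^ (A + 1)) (x : WG) :
    ∃ (p₀ : WinParam) (p₁ p₂ : ℕ → WinParam), Set.InjOn p₁ (range A) ∧ Set.InjOn p₂ (range A) ∧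
      |∑ m ∈ range n, c (n - m) * kacz m x| ≤ 2 * c n *
        (winKer θ A p₀ x + ∑ B ∈ range A, winKer θ A (p₁ B) x
          + ∑ b ∈ range A, winKer θ A (p₂ b) x) := by
  have hθ0 : 0 ≤ θ := by linarith
  have hK : ∀ p, 0 ≤ winKer θ A p x := fun p => winKer_nonneg hθ0 A p x
  have hcA : 0 ≤ c (2 ^ A) := hc.nonneg _
  have hcn : c (2 ^ A) ≤ c n := hc.mono h1
  by_cases hx : ∃ i < A, x i = 1
  · classical
    set B₀ := Nat.find hx with hB₀
    obtain ⟨hBA, hB1⟩ := Nat.find_spec hx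
    rw [← hB₀] at hBA hB1
    have hmin : ∀ i < B₀, x i = 0 := fun i hi =>
      (zmod_two_cases (x i)).resolve_right fun hi' => Nat.find_min hx hi ⟨hi.trans hBA, hi'⟩
    have hradB : rad B₀ x = -1 := by rw [rad_eq, hB1, if_neg (by decide)]
    have hradl : ∀ i < B₀, rad i x = 1 := fun i hi => by rw [rad_eq, hmin i hi, if_pos rfl]
    have hlow : ∀ B, ∃ t u, B₀ < B → B < A → ∀ N, 2 ^ B ≤ N →
        |signSum c (fun i => rad (B - 1 - i) x) B N|
          ≤ c (2 ^ A) * winKer θ A (0, A - B, t, u) x := by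
      intro B
      by_cases hB : B₀ < B ∧ B < A
      · obtain ⟨t, u, h⟩ := lower_block_le hc hθ hdec hB.2 x ⟨B₀, hB.1, hB1⟩
        exact ⟨t, u, fun _ _ => h⟩
      · exact ⟨0, 0, fun a b => absurd ⟨a, b⟩ hB⟩
    have htop : ∀ b, ∃ t u, b < A → ∀ N, 2 ^ b ≤ N → N < 2 ^ (b + 1) →
        |signSum c (fun i => rad (A - 1 - i) x) b N|
          ≤ 2 * c (2 ^ A) * winKer θ A (A - b, 0, t, u) x := by
      intro b
      by_cases hb : b < A
      · obtain ⟨t, u, h⟩ := top_block_le hc hθ hdec hb x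
        exact ⟨t, u, fun _ => h⟩
      · exact ⟨0, 0, fun a => absurd a hb⟩
    choose t u hlow using hlow
    choose t' u' htop using htop
    refine ⟨(0, A - B₀, 0, 0), fun B => (0, A - B, t B, u B), fun b => (A - b, 0, t' b, u' b),
      ?_, ?_, ?_⟩
    · intro B hB B' hB' h
      simp only [coe_range, Set.mem_Iio] at hB hB'
      simp only [Prod.mk.injEq] at h
      omega
    · intro B hB B' hB' h
      simp only [coe_range, Set.mem_Iio] at hB hB'
      simp only [Prod.mk.injEq] at h
      omega
    obtain ⟨q, rfl⟩ := Nat.exists_eq_add_of_le h1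
    rw [pow_succ] at h2
    rw [sum_range_add, sum_range_two_pow_split _ (show B₀ + 1 ≤ A from hBA)]
    have e1 : ∑ m ∈ range (2 ^ (B₀ + 1)), c (2 ^ A + q - m) * kacz m x
        = signSum c (fun i => rad i x) (B₀ + 1) (2 ^ A + q) := by
      rw [← sum_digitSign_two_pow]
      apply sum_congr rfl
      intro m hm
      congr 1
      have hm' := mem_range.1 hm
      rw [pow_succ] at hm'
      by_cases hm2 : m < 2 ^ B₀
      · rw [kacz_eq_one hm2 hmin, digitSign_eq_one hm2 hradl]
      · obtain ⟨l, rfl⟩ := Nat.exists_eq_add_of_le (not_lt.1 hm2)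
        rw [kacz_eq (by omega), digitSign_two_pow_add _ (by omega),
          digitSign_eq_one (show l < 2 ^ B₀ by omega) hradl,
          digitSign_eq_one (show l < 2 ^ B₀ by omega) fun i hi => hradl _ (by omega)]
    have e2 : ∀ B, ∑ l ∈ range (2 ^ B), c (2 ^ A + q - (2 ^ B + l)) * kacz (2 ^ B + l) x
        = rad B x * signSum c (fun i => rad (B - 1 - i) x) B (2 ^ A + q - 2 ^ B) := by
      intro B
      rw [← sum_digitSign_two_pow, mul_sum]
      apply sum_congr rfl
      intro l hl
      rw [kacz_eq (mem_range.1 hl), Nat.sub_sub]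
      ring
    have e3 : ∑ l ∈ range q, c (2 ^ A + q - (2 ^ A + l)) * kacz (2 ^ A + l) x
        = rad A x * ∑ l ∈ range q, c (q - l) * digitSign (fun i => rad (A - 1 - i) x) l := by
      rw [mul_sum]
      apply sum_congr rfl
      intro l hl
      have := mem_range.1 hl
      rw [kacz_eq (by omega), Nat.add_sub_add_left]
      ring
    have hpow : ∀ B < A, 2 ^ B + 2 ^ B ≤ 2 ^ A := fun B hB => by
      have := Nat.pow_le_pow_right (n := 2) (by norm_num) hB
      rw [Nat.succ_eq_add_one, pow_succ] at this
      omega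
    have b1 : |signSum c (fun i => rad i x) (B₀ + 1) (2 ^ A + q)|
        ≤ 2 * c (2 ^ A) * winKer θ A (0, A - B₀, 0, 0) x := by
      refine (abs_signSum_le hc (fun i => abs_rad i x) (Nat.lt_succ_self B₀) le_rfl hradB
        (fun i hi hne => hradl i (by omega)) (Or.inl rfl) _ ?_).trans ?_
      · have := hpow B₀ hBA
        rw [pow_succ]
        omega
      · rw [winKer_of_inWin]
        · simp only [WinParam.size, winLen]
          rw [show A - (A - B₀) - (0 + 0) = B₀ by omega,
            show 0 + (A - B₀) + 0 + 0 = A - (B₀ + 1) + 1 by omega, pow_succ]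
          have h5 := hdec (B₀ + 1) (by omega)
          calc (2 : ℝ) ^ B₀ * c (2 ^ (B₀ + 1))
              ≤ 2 ^ B₀ * (θ ^ (A - (B₀ + 1)) * c (2 ^ A)) := by gcongr
            _ ≤ (2 * θ) * (2 ^ B₀ * (θ ^ (A - (B₀ + 1)) * c (2 ^ A))) :=
                le_mul_of_one_le_left (by positivity) (by linarith)
            _ = _ := by ring
        · intro j hj hjA
          simp only at hj hjA ⊢
          rw [if_neg (by omega), hmin j (by omega)]
    have b2 : |∑ B ∈ Ico (B₀ + 1) A,
          rad B x * signSum c (fun i => rad (B - 1 - i) x) B (2 ^ A + q - 2 ^ B)|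
        ≤ ∑ B ∈ range A, c (2 ^ A) * winKer θ A (0, A - B, t B, u B) x := by
      refine (abs_sum_le_sum_abs _ _).trans ?_
      refine (sum_le_sum (g := fun B => c (2 ^ A) * winKer θ A (0, A - B, t B, u B) x) ?_).trans
        (sum_le_sum_of_subset_of_nonneg ?_ ?_)
      · intro B hB
        rw [mem_Ico] at hB
        rw [abs_mul, abs_rad, one_mul]
        have := hpow B hB.2
        exact hlow B (by omega) hB.2 _ (by omega)
      · intro B hB
        rw [mem_Ico] at hB
        exact mem_range.2 hB.2
      · intro B _ _
        exact mul_nonneg hcA (hK _)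
    have b3 : |∑ l ∈ range q, c (q - l) * digitSign (fun i => rad (A - 1 - i) x) l|
        ≤ ∑ b ∈ range A, 2 * c (2 ^ A) * winKer θ A (A - b, 0, t' b, u' b) x :=
      abs_sum_digitSign_le (fun i => abs_rad _ x)
        (fun b => mul_nonneg (by positivity) (hK _)) htop q (by omega)
    rw [e1, sum_congr rfl fun B _ => e2 B, e3]
    rw [← mul_sum] at b2 b3
    have s1 : 0 ≤ ∑ B ∈ range A, winKer θ A (0, A - B, t B, u B) x := sum_nonneg fun _ _ => hK _
    have s2 : 0 ≤ ∑ b ∈ range A, winKer θ A (A - b, 0, t' b, u' b) x := sum_nonneg fun _ _ => hK _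
    have s0 := hK (0, A - B₀, 0, 0)
    refine (abs_add_three _ _ _).trans ?_
    rw [abs_mul (rad A x), abs_rad, one_mul]
    calc _ ≤ 2 * c (2 ^ A) * winKer θ A (0, A - B₀, 0, 0) x
          + c (2 ^ A) * ∑ B ∈ range A, winKer θ A (0, A - B, t B, u B) x
          + 2 * c (2 ^ A) * ∑ b ∈ range A, winKer θ A (A - b, 0, t' b, u' b) x := by gcongr
      _ ≤ 2 * c (2 ^ A) * (winKer θ A (0, A - B₀, 0, 0) x
          + ∑ B ∈ range A, winKer θ A (0, A - B, t B, u B) x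
          + ∑ b ∈ range A, winKer θ A (A - b, 0, t' b, u' b) x) := by
        nlinarith [mul_nonneg hcA s1]
      _ ≤ _ := by gcongr
  · push Not at hx
    have hx' : ∀ i < A, x i = 0 := fun i hi => (zmod_two_cases (x i)).resolve_right (hx i hi)
    refine ⟨(0, 0, 0, 0), fun B => (0, A - B, 0, 0), fun B => (0, A - B, 0, 0), ?_, ?_, ?_⟩
    · intro B hB B' hB' h
      simp only [coe_range, Set.mem_Iio] at hB hB'
      simp only [Prod.mk.injEq] at h
      omega
    · intro B hB B' hB' h
      simp only [coe_range, Set.mem_Iio] at hB hB'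
      simp only [Prod.mk.injEq] at h
      omega
    · have b1 : |∑ m ∈ range n, c (n - m) * kacz m x| ≤ n * c n := by
        refine (abs_sum_le_sum_abs _ _).trans ?_
        rw [← nsmul_eq_mul, ← card_range n, ← sum_const, card_range]
        apply sum_le_sum
        intro m _
        rw [abs_mul, abs_kacz, mul_one, abs_of_nonneg (hc.nonneg _)]
        exact hc.mono (Nat.sub_le _ _)
      have b2 : winKer θ A (0, 0, 0, 0) x = 2 ^ A := by
        rw [winKer_of_inWin]
        · simp [WinParam.size, winLen]
        · intro j hj hjA
          simp only at hj hjA ⊢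
          rw [if_neg (by omega), hx' j (by omega)]
      have b3 : (n : ℝ) ≤ 2 * 2 ^ A := by
        rw [pow_succ'] at h2
        exact_mod_cast h2.le
      have s1 : 0 ≤ ∑ B ∈ range A, winKer θ A (0, A - B, 0, 0) x := sum_nonneg fun _ _ => hK _
      have hcn' : 0 ≤ c n := hc.nonneg _
      rw [b2]
      calc _ ≤ n * c n := b1
        _ ≤ (2 * 2 ^ A) * c n := by gcongr
        _ ≤ (2 * c n) * 2 ^ A := by linarith
        _ ≤ _ := by
          gcongr
          linarith

end KernelBound

section Maximal

variable {X : Type*} [MeasurableSpace X] {μ : Measure X}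

lemma measurable_setLIntegral_section [SFinite μ] {S : X → Set X}
    (hS : MeasurableSet {q : X × X | q.2 ∈ S q.1}) {g : X → ℝ≥0∞} (hg : Measurable g) :
    Measurable fun x => ∫⁻ t in S x, g t ∂μ := by
  have h : ∀ x, ∫⁻ t in S x, g t ∂μ
      = ∫⁻ t, {q : X × X | q.2 ∈ S q.1}.indicator (fun q => g q.2) (x, t) ∂μ := by
    intro x
    have hSx : MeasurableSet (S x) := measurable_prodMk_left hS
    rw [← lintegral_indicator hSx]
    rfl
  simp only [h]
  exact ((hg.comp measurable_snd).indicator hS).lintegral_prod_right'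

/-- The maximal function of a nested sequence of averaging operators is of weak type `(1,1)`. -/
lemma weak_type_of_nested [SFinite μ] {R : ℕ → X → Set X} {κ : ℕ → ℝ≥0∞}
    (hR : ∀ a, MeasurableSet {q : X × X | q.2 ∈ R a q.1})
    (hsize : ∀ a t, κ a * μ {x | t ∈ R a x} ≤ 1)
    (hnest : ∀ a b, b ≤ a → ∀ x, R a x ⊆ R b x)
    (hcoset : ∀ a x x' t, t ∈ R a x → t ∈ R a x' → R a x = R a x')
    {g : X → ℝ≥0∞} (hg : Measurable g) (lam : ℝ≥0∞) :
    lam * μ {x | lam < ⨆ a, κ a * ∫⁻ t in R a x, g t ∂μ} ≤ ∫⁻ t, g t ∂μ := by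
  set E : ℕ → X → ℝ≥0∞ := fun a x => κ a * ∫⁻ t in R a x, g t ∂μ with hE
  have hEm : ∀ a, Measurable (E a) := fun a =>
    (measurable_setLIntegral_section (hR a) hg).const_mul _
  set B : ℕ → Set X := fun a => {x | lam < E a x} ∩ ⋂ b : Fin a, {x | E b x ≤ lam} with hB
  have hBm : ∀ a, MeasurableSet (B a) := fun a =>
    (measurableSet_lt measurable_const (hEm a)).inter
      (MeasurableSet.iInter fun b => measurableSet_le (hEm b) measurable_const)
  have hsub : {x | lam < ⨆ a, E a x} ⊆ ⋃ a, B a := by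
    intro x hx
    have hx' : ∃ a, lam < E a x := lt_iSup_iff.1 hx
    classical
    refine Set.mem_iUnion.2 ⟨Nat.find hx', Nat.find_spec hx', Set.mem_iInter.2 fun b => ?_⟩
    exact not_lt.1 (Nat.find_min hx' b.2)
  have hone : ∀ t, ∑' a, κ a * μ (B a ∩ {x | t ∈ R a x}) ≤ 1 := by
    intro t
    have huniq : ∀ a b, b < a → (B a ∩ {x | t ∈ R a x}).Nonempty →
        (B b ∩ {x | t ∈ R b x}).Nonempty → False := by
      rintro a b hab ⟨x, hx, hxt⟩ ⟨x', hx', hxt'⟩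
      have h1 := hcoset b x x' t (hnest a b hab.le x hxt) hxt'
      have h2 : E b x ≤ lam := Set.mem_iInter.1 hx.2 ⟨b, hab⟩
      have h3 : lam < E b x' := hx'.1
      have h4 : E b x = E b x' := by simp only [hE, h1]
      exact absurd (h4 ▸ h2) (not_le.2 h3)
    by_cases h : ∃ a, (B a ∩ {x | t ∈ R a x}).Nonempty
    · obtain ⟨a, ha⟩ := h
      rw [tsum_eq_single a]
      · exact (mul_le_mul_right (measure_mono Set.inter_subset_right) _).trans (hsize a t)
      · intro b hb
        rcases Set.eq_empty_or_nonempty (B b ∩ {x | t ∈ R b x}) with h0 | h0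
        · rw [h0, measure_empty, mul_zero]
        · rcases lt_or_gt_of_ne hb with h1 | h1
          · exact (huniq a b h1 ha h0).elim
          · exact (huniq b a h1 h0 ha).elim
    · push Not at h
      simp [h]
  have hBint : ∀ a, lam * μ (B a) ≤ ∫⁻ t, g t * (κ a * μ (B a ∩ {x | t ∈ R a x})) ∂μ := by
    intro a
    have m1 : Measurable (Function.uncurry fun x t =>
        (B a).indicator (fun x => κ a * (R a x).indicator g t) x) := by
      have e : (Function.uncurry fun x t => (B a).indicator (fun x => κ a * (R a x).indicator g t) x)
          = (Prod.fst ⁻¹' (B a)).indicator (fun q : X × X =>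
            κ a * {q : X × X | q.2 ∈ R a q.1}.indicator (fun q => g q.2) q) := by
        ext ⟨x, t⟩
        rfl
      rw [e]
      exact (((hg.comp measurable_snd).indicator (hR a)).const_mul _).indicator
        (measurable_fst (hBm a))
    calc lam * μ (B a) = ∫⁻ _ in B a, lam ∂μ := by rw [setLIntegral_const]
      _ ≤ ∫⁻ x in B a, E a x ∂μ := setLIntegral_mono (hEm a) fun x hx => hx.1.le
      _ = ∫⁻ x, (B a).indicator (E a) x ∂μ := (lintegral_indicator (hBm a) _).symm
      _ = ∫⁻ x, ∫⁻ t, (B a).indicator (fun x => κ a * (R a x).indicator g t) x ∂μ ∂μ := by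
        apply lintegral_congr
        intro x
        by_cases hx : x ∈ B a
        · have hRx : MeasurableSet (R a x) := measurable_prodMk_left (hR a)
          simp only [Set.indicator_of_mem hx, hE]
          rw [lintegral_const_mul _ (hg.indicator hRx), lintegral_indicator hRx]
        · simp [Set.indicator_of_notMem hx]
      _ = ∫⁻ t, ∫⁻ x, (B a).indicator (fun x => κ a * (R a x).indicator g t) x ∂μ ∂μ :=
        lintegral_lintegral_swap m1.aemeasurable
      _ = ∫⁻ t, g t * (κ a * μ (B a ∩ {x | t ∈ R a x})) ∂μ := by
        apply lintegral_congr
        intro t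
        have hRt : MeasurableSet {x | t ∈ R a x} := measurable_prodMk_right (hR a)
        have e : (fun x => (B a).indicator (fun x => κ a * (R a x).indicator g t) x)
            = (B a ∩ {x | t ∈ R a x}).indicator fun _ => κ a * g t := by
          ext x
          by_cases hx : x ∈ B a <;> by_cases hxt : t ∈ R a x <;> simp [hx, hxt, Set.indicator]
        rw [e, lintegral_indicator ((hBm a).inter hRt), setLIntegral_const]
        ring
  calc lam * μ {x | lam < ⨆ a, E a x} ≤ lam * ∑' a, μ (B a) := by
        gcongr
        exact (measure_mono hsub).trans (measure_iUnion_le _)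
    _ = ∑' a, lam * μ (B a) := ENNReal.tsum_mul_left.symm
    _ ≤ ∑' a, ∫⁻ t, g t * (κ a * μ (B a ∩ {x | t ∈ R a x})) ∂μ := ENNReal.tsum_le_tsum hBint
    _ = ∫⁻ t, ∑' a, g t * (κ a * μ (B a ∩ {x | t ∈ R a x})) ∂μ := by
        rw [lintegral_tsum]
        intro a
        refine (hg.mul (Measurable.const_mul ?_ _)).aemeasurable
        have hm : MeasurableSet ((Prod.fst ⁻¹' (B a)) ∩ {q : X × X | q.2 ∈ R a q.1}) :=
          (measurable_fst (hBm a)).inter (hR a)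
        exact measurable_measure_prodMk_right hm
    _ ≤ ∫⁻ t, g t ∂μ := by
        apply lintegral_mono
        intro t
        dsimp only
        rw [ENNReal.tsum_mul_left]
        exact mul_le_of_le_one_right' (hone t)

/-- Summation of weak type inequalities with summable square roots of the weights. -/
lemma weak_type_tsum {ι : Type*} [Countable ι] [Nonempty ι] {H : ι → ℝ≥0∞}
    (hH : ∑' p, H p ≠ ⊤) (hH0 : ∀ p, H p ≠ 0) {T : ι → X → ℝ≥0∞} {I : ℝ≥0∞}
    (hT : ∀ p lam, lam * μ {x | lam < T p x} ≤ I) (lam : ℝ≥0∞) :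
    lam * μ {x | lam < ∑' p, H p ^ 2 * T p x} ≤ (∑' p, H p) ^ 2 * I := by
  set Z := ∑' p, H p with hZ
  have hHt : ∀ p, H p ≠ ⊤ := fun p => ENNReal.ne_top_of_tsum_ne_top hH p
  have hZ0 : Z ≠ 0 := by
    obtain ⟨p⟩ := ‹Nonempty ι›
    exact fun h => hH0 p (ENNReal.tsum_eq_zero.1 h p)
  have hsub : {x | lam < ∑' p, H p ^ 2 * T p x} ⊆ ⋃ p, {x | lam / (Z * H p) < T p x} := by
    intro x hx
    by_contra h
    have h' : ∀ p, T p x ≤ lam / (Z * H p) := fun p =>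
      not_lt.1 fun hp => h (Set.mem_iUnion.2 ⟨p, hp⟩)
    have hx' : lam < ∑' p, H p ^ 2 * T p x := hx
    refine absurd hx' (not_lt.2 ?_)
    calc ∑' p, H p ^ 2 * T p x ≤ ∑' p, H p * (lam / Z) := by
          apply ENNReal.tsum_le_tsum
          intro p
          calc H p ^ 2 * T p x ≤ H p ^ 2 * (lam / (Z * H p)) := by gcongr; exact h' p
            _ = H p * (lam / Z) * (H p * (H p)⁻¹) := by
              rw [div_eq_mul_inv, div_eq_mul_inv, ENNReal.mul_inv (Or.inl hZ0) (Or.inl hH)]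
              ring
            _ = H p * (lam / Z) := by rw [ENNReal.mul_inv_cancel (hH0 p) (hHt p), mul_one]
      _ = Z * (lam / Z) := by rw [ENNReal.tsum_mul_right]
      _ = lam := ENNReal.mul_div_cancel hZ0 hH
  calc lam * μ {x | lam < ∑' p, H p ^ 2 * T p x}
      ≤ lam * ∑' p, μ {x | lam / (Z * H p) < T p x} := by
        gcongr
        exact (measure_mono hsub).trans (measure_iUnion_le _)
    _ = ∑' p, lam * μ {x | lam / (Z * H p) < T p x} := ENNReal.tsum_mul_left.symm
    _ ≤ ∑' p, Z * H p * I := by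
        apply ENNReal.tsum_le_tsum
        intro p
        have h0 : Z * H p ≠ 0 := mul_ne_zero hZ0 (hH0 p)
        have ht : Z * H p ≠ ⊤ := ENNReal.mul_ne_top hH (hHt p)
        calc lam * μ {x | lam / (Z * H p) < T p x}
            = Z * H p * (lam / (Z * H p) * μ {x | lam / (Z * H p) < T p x}) := by
              rw [← mul_assoc, ENNReal.mul_div_cancel h0 ht]
          _ ≤ _ := by gcongr; exact hT p _
    _ = Z ^ 2 * I := by
        rw [ENNReal.tsum_mul_right, ENNReal.tsum_mul_left, sq]

lemma lintegral_Ioo_rpow {p a : ℝ} (hp : 1 < p) (ha : 0 ≤ a) :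
    ∫⁻ t in Set.Ioo 0 a, ENNReal.ofReal (t ^ (p - 2)) = ENNReal.ofReal (a ^ (p - 1) / (p - 1)) := by
  rw [setLIntegral_congr Ioo_ae_eq_Ioc, ← ofReal_integral_eq_lintegral_ofReal,
    ← intervalIntegral.integral_of_le ha, integral_rpow (Or.inl (by linarith)),
    show p - 2 + 1 = p - 1 by ring, Real.zero_rpow (by linarith), sub_zero]
  · exact (intervalIntegral.intervalIntegrable_rpow' (by linarith)).1
  · filter_upwards [ae_restrict_mem measurableSet_Ioc] with t ht
    exact Real.rpow_nonneg ht.1.le _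

/-- The Marcinkiewicz interpolation argument between weak type `(1,1)` and type `(∞,∞)`. -/
lemma lintegral_rpow_le_of_weak_type [SFinite μ] {T : X → ℝ≥0∞} (hT : Measurable T) {g : X → ℝ}
    (hg : Measurable g) (hg0 : ∀ x, 0 ≤ g x) (hgi : ∫⁻ x, ENNReal.ofReal (g x) ∂μ ≠ ⊤)
    {W : ℝ≥0∞} (hW : W ≠ ⊤) {K : ℝ} (hK : 0 < K)
    (hw : ∀ t : ℝ, 0 < t → ENNReal.ofReal t * μ {x | ENNReal.ofReal t < T x}
      ≤ W * ∫⁻ x in {x | t < K * g x}, ENNReal.ofReal (g x) ∂μ) {p : ℝ} (hp : 1 < p) :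
    ∫⁻ x, T x ^ p ∂μ ≤ ENNReal.ofReal p * W * ENNReal.ofReal (K ^ (p - 1) / (p - 1))
      * ∫⁻ x, ENNReal.ofReal (g x) ^ p ∂μ := by
  have hp0 : 0 < p := by linarith
  have hfin : ∀ᵐ x ∂μ, T x ≠ ⊤ := by
    set J := W * ∫⁻ x, ENNReal.ofReal (g x) ∂μ with hJ
    have hJt : J ≠ ⊤ := ENNReal.mul_ne_top hW hgi
    have hb : ∀ n : ℕ, 0 < n → (n : ℝ≥0∞) * μ {x | T x = ⊤} ≤ J := by
      intro n hn
      have h1 := hw n (by exact_mod_cast hn)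
      rw [ENNReal.ofReal_natCast] at h1
      refine le_trans ?_ (h1.trans (mul_le_mul_right (setLIntegral_le_lintegral _ _) _))
      refine mul_le_mul_right (measure_mono fun x (hx : T x = ⊤) => ?_) _
      exact lt_of_lt_of_eq (ENNReal.natCast_lt_top n) hx.symm
    rw [ae_iff]
    simp only [ne_eq, not_not]
    by_contra h0
    obtain ⟨n, hn⟩ := ENNReal.exists_nat_gt (ENNReal.div_ne_top hJt h0)
    have hn0 : 0 < n := by
      rcases Nat.eq_zero_or_pos n with rfl | h
      · simp at hn
      · exact h
    have hle := hb n hn0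
    have h2 : J < n * μ {x | T x = ⊤} := by
      by_cases htop : μ {x | T x = ⊤} = ⊤
      · rw [htop, ENNReal.mul_top (by exact_mod_cast hn0.ne')]
        exact lt_top_iff_ne_top.2 hJt
      · exact (ENNReal.div_lt_iff (Or.inl h0) (Or.inl htop)).1 hn
    exact absurd hle (not_le.2 h2)
  have e1 : ∫⁻ x, T x ^ p ∂μ = ∫⁻ x, ENNReal.ofReal ((T x).toReal ^ p) ∂μ := by
    apply lintegral_congr_ae
    filter_upwards [hfin] with x hx
    rw [← ENNReal.ofReal_rpow_of_nonneg ENNReal.toReal_nonneg hp0.le, ENNReal.ofReal_toReal hx]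
  rw [e1, lintegral_rpow_eq_lintegral_meas_lt_mul μ (ae_of_all _ fun _ => ENNReal.toReal_nonneg)
    hT.ennreal_toReal.aemeasurable hp0]
  have hset : MeasurableSet {q : ℝ × X | q.1 < K * g q.2} :=
    measurableSet_lt measurable_fst ((hg.comp measurable_snd).const_mul K)
  have hgm : Measurable fun x => ENNReal.ofReal (g x) := hg.ennreal_ofReal
  have step : ∀ t ∈ Set.Ioi (0 : ℝ), μ {x | t < (T x).toReal} * ENNReal.ofReal (t ^ (p - 1))
      ≤ W * ∫⁻ x, ENNReal.ofReal (t ^ (p - 2)) *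
        {q : ℝ × X | q.1 < K * g q.2}.indicator (fun q => ENNReal.ofReal (g q.2)) (t, x) ∂μ := by
    intro t ht
    have ht0 : (0 : ℝ) < t := ht
    have h1 : μ {x | t < (T x).toReal} ≤ μ {x | ENNReal.ofReal t < T x} := by
      apply measure_mono
      intro x hx
      exact ((ENNReal.ofReal_lt_ofReal_iff (ht0.trans hx)).2 hx).trans_le ENNReal.ofReal_toReal_le
    have e2 : t ^ (p - 1) = t * t ^ (p - 2) := by
      rw [← Real.rpow_one_add' ht0.le (by linarith)]
      congr 1
      ring
    have hsec : MeasurableSet {x | t < K * g x} := measurable_prodMk_left hset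
    calc μ {x | t < (T x).toReal} * ENNReal.ofReal (t ^ (p - 1))
        ≤ μ {x | ENNReal.ofReal t < T x} * (ENNReal.ofReal t * ENNReal.ofReal (t ^ (p - 2))) := by
          rw [e2, ENNReal.ofReal_mul ht0.le]
          gcongr
      _ = ENNReal.ofReal (t ^ (p - 2)) *
          (ENNReal.ofReal t * μ {x | ENNReal.ofReal t < T x}) := by ring
      _ ≤ ENNReal.ofReal (t ^ (p - 2)) *
          (W * ∫⁻ x in {x | t < K * g x}, ENNReal.ofReal (g x) ∂μ) := by
          exact mul_le_mul_right (hw t ht0) _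
      _ = _ := by
          rw [lintegral_const_mul', ← lintegral_indicator hsec]
          · rw [mul_left_comm]
            rfl
          · exact ENNReal.ofReal_ne_top
  have inner : ∀ x, ∫⁻ t in Set.Ioi (0 : ℝ), ENNReal.ofReal (t ^ (p - 2)) *
        {q : ℝ × X | q.1 < K * g q.2}.indicator (fun q => ENNReal.ofReal (g q.2)) (t, x)
      = ENNReal.ofReal (K ^ (p - 1) / (p - 1)) * ENNReal.ofReal (g x) ^ p := by
    intro x
    have e3 : ∀ t, ENNReal.ofReal (t ^ (p - 2)) *
        {q : ℝ × X | q.1 < K * g q.2}.indicator (fun q => ENNReal.ofReal (g q.2)) (t, x)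
        = ENNReal.ofReal (g x) *
          (Set.Iio (K * g x)).indicator (fun t => ENNReal.ofReal (t ^ (p - 2))) t := by
      intro t
      by_cases h : t < K * g x
      · rw [Set.indicator_of_mem (by exact h), Set.indicator_of_mem (by exact h), mul_comm]
      · rw [Set.indicator_of_notMem (by exact h), Set.indicator_of_notMem (by exact h)]
        simp
    simp only [e3]
    rw [lintegral_const_mul' _ _ ENNReal.ofReal_ne_top, lintegral_indicator measurableSet_Iio,
      Measure.restrict_restrict measurableSet_Iio, Set.Iio_inter_Ioi,
      lintegral_Ioo_rpow hp (mul_nonneg hK.le (hg0 x)),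
      ENNReal.ofReal_rpow_of_nonneg (hg0 x) hp0.le, ← ENNReal.ofReal_mul (hg0 x),
      ← ENNReal.ofReal_mul (div_nonneg (Real.rpow_nonneg hK.le _) (by linarith))]
    congr 1
    rw [Real.mul_rpow hK.le (hg0 x), show g x ^ p = g x * g x ^ (p - 1) by
      rw [← Real.rpow_one_add' (hg0 x) (by linarith)]
      congr 1
      ring]
    ring
  have hmeas : Measurable (Function.uncurry fun (t : ℝ) (x : X) => ENNReal.ofReal (t ^ (p - 2)) *
        {q : ℝ × X | q.1 < K * g q.2}.indicator (fun q => ENNReal.ofReal (g q.2)) (t, x)) := by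
    apply Measurable.mul
    · exact (measurable_fst.pow_const _).ennreal_ofReal
    · exact (hgm.comp measurable_snd).indicator hset
  calc _ ≤ ENNReal.ofReal p * ∫⁻ t in Set.Ioi (0 : ℝ),
        W * ∫⁻ x, ENNReal.ofReal (t ^ (p - 2)) *
        {q : ℝ × X | q.1 < K * g q.2}.indicator (fun q => ENNReal.ofReal (g q.2)) (t, x) ∂μ := by
        gcongr ENNReal.ofReal p * ?_
        exact setLIntegral_mono' measurableSet_Ioi step
    _ = _ := by
        rw [lintegral_const_mul' _ _ hW, lintegral_lintegral_swap hmeas.aemeasurable,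
          lintegral_congr inner, lintegral_const_mul' _ _ ENNReal.ofReal_ne_top]
        ring

end Maximal

section Measure

lemma μW_univ : μW Set.univ = 1 := by
  have h := Measure.addHaarMeasure_self (K₀ := (⊤ : TopologicalSpace.PositiveCompacts WG))
  rwa [TopologicalSpace.PositiveCompacts.coe_top] at h

instance : IsProbabilityMeasure μW := ⟨μW_univ⟩

instance : μW.IsAddLeftInvariant := by unfold μW; infer_instance

instance (d : ℕ) : IsProbabilityMeasure (μD d) := by unfold μD; infer_instance

lemma measurable_coord (i : ℕ) : Measurable fun x : WG => x i := measurable_pi_apply i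

lemma measurableSet_cylinder (W : Finset ℕ) (v : WG) :
    MeasurableSet {x : WG | ∀ i ∈ W, x i = v i} := by
  have : {x : WG | ∀ i ∈ W, x i = v i} = ⋂ i ∈ W, {x | x i = v i} := by ext; simp
  rw [this]
  exact Finset.measurableSet_biInter _ fun i _ =>
    measurable_coord i (measurableSet_singleton (v i))

lemma two_pow_mul_μW_cylinder_le (W : Finset ℕ) (v : WG) :
    2 ^ #W * μW {x | ∀ i ∈ W, x i = v i} ≤ 1 := by
  classical
  induction W using Finset.induction_on with
  | empty => simp
  | insert i W hi ih =>
    refine le_trans ?_ ih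
    rw [card_insert_of_notMem hi, pow_succ, mul_assoc]
    gcongr
    set C : Set WG := {x | ∀ k ∈ insert i W, x k = v k} with hC
    have hCm : MeasurableSet C := measurableSet_cylinder _ v
    have hpre : μW ((fun x => Pi.single i 1 + x) ⁻¹' C) = μW C :=
      measure_preimage_add μW (Pi.single i 1) C
    have hdisj : Disjoint C ((fun x => Pi.single i 1 + x) ⁻¹' C) := by
      rw [Set.disjoint_left]
      intro x hx hx'
      have h1 : x i = v i := hx i (mem_insert_self i W)
      have h2 : (Pi.single i 1 + x : WG) i = v i := hx' i (mem_insert_self i W)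
      rw [Pi.add_apply, Pi.single_eq_same, h1] at h2
      simp at h2
    calc 2 * μW C = μW C + μW ((fun x => Pi.single i 1 + x) ⁻¹' C) := by rw [hpre, two_mul]
      _ = μW (C ∪ (fun x => Pi.single i 1 + x) ⁻¹' C) := (measure_union' hdisj hCm).symm
      _ ≤ μW {x | ∀ i ∈ W, x i = v i} := by
        apply measure_mono
        rintro x (hx | hx) k hk
        · exact hx k (mem_insert_of_mem hk)
        · have h : (Pi.single i 1 + x : WG) k = v k := hx k (mem_insert_of_mem hk)
          have hne : k ≠ i := fun e => hi (e ▸ hk)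
          simpa [Pi.single_eq_of_ne hne] using h

end Measure

section Windows

/-- The digit pattern prescribed on a window. -/
def winPattern (p : WinParam) : WG := fun i => if i + 1 = p.1 + p.2.2.1 + p.2.2.2 then 1 else 0

lemma inWin_iff (A : ℕ) (p : WinParam) (x : WG) :
    InWin A p x ↔ ∀ i ∈ Ico (p.1 + p.2.2.1) (A - p.2.1), x i = winPattern p i := by
  constructor
  · intro h i hi
    rw [mem_Ico] at hi
    exact h i hi.1 (by omega)
  · intro h i h1 h2
    exact h i (mem_Ico.2 ⟨h1, by omega⟩)

lemma InWin.mono {A B : ℕ} (hBA : B ≤ A) {p : WinParam} {x : WG} (h : InWin A p x) :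
    InWin B p x := fun i h1 h2 => h i h1 (h2.trans_le hBA)

lemma measurableSet_inWin (A : ℕ) (p : WinParam) : MeasurableSet {x | InWin A p x} := by
  simp only [inWin_iff]
  exact measurableSet_cylinder _ _

lemma two_pow_mul_μW_inWin_le (A : ℕ) (p : WinParam) (t : WG) :
    2 ^ winLen A p * μW {x | InWin A p (x + t)} ≤ 1 := by
  have h := two_pow_mul_μW_cylinder_le (Ico (p.1 + p.2.2.1) (A - p.2.1)) (winPattern p)
  have e : μW {x | InWin A p (x + t)} = μW {x | InWin A p x} := by
    have h2 := measure_preimage_add μW t {x | InWin A p x}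
    rw [← h2]
    congr 1
    ext x
    change InWin A p (x + t) ↔ InWin A p (t + x)
    rw [add_comm]
  rw [e]
  simp only [inWin_iff]
  rw [Nat.card_Ico] at h
  exact h

/-- Points `t` for which all coordinates of `x + t` lie in the windows `p`. -/
def winRect {d : ℕ} (N : Fin d → ℕ) (p : Fin d → WinParam) (x : Fin d → WG) :
    Set (Fin d → WG) := {t | ∀ i, InWin (N i) (p i) (x i + t i)}

lemma winRect_antitone {d : ℕ} {N M : Fin d → ℕ} (h : M ≤ N) (p : Fin d → WinParam)
    (x : Fin d → WG) : winRect N p x ⊆ winRect M p x := fun _ ht i => (ht i).mono (h i)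

lemma winRect_eq_of_mem {d : ℕ} {N : Fin d → ℕ} {p : Fin d → WinParam} {x y t : Fin d → WG}
    (hx : t ∈ winRect N p x) (hy : t ∈ winRect N p y) : winRect N p x = winRect N p y := by
  have key : ∀ i k, (p i).1 + (p i).2.2.1 ≤ k → k + (p i).2.1 < N i → x i k = y i k := by
    intro i k h1 h2
    have e := (hx i k h1 h2).trans (hy i k h1 h2).symm
    exact add_right_cancel e
  ext s
  refine forall_congr' fun i => forall_congr' fun k => forall_congr' fun h1 =>
    forall_congr' fun h2 => ?_
  rw [Pi.add_apply, Pi.add_apply, key i k h1 h2]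

lemma measurableSet_winRect {d : ℕ} (N : Fin d → ℕ) (p : Fin d → WinParam) :
    MeasurableSet {q : (Fin d → WG) × (Fin d → WG) | q.2 ∈ winRect N p q.1} := by
  have : {q : (Fin d → WG) × (Fin d → WG) | q.2 ∈ winRect N p q.1}
      = ⋂ i, (fun q : (Fin d → WG) × (Fin d → WG) => q.1 i + q.2 i) ⁻¹'
        {x | InWin (N i) (p i) x} := by
    ext q
    simp [winRect]
  rw [this]
  refine MeasurableSet.iInter fun i => ?_
  have hm : Measurable fun q : (Fin d → WG) × (Fin d → WG) => q.1 i + q.2 i := by fun_prop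
  exact hm (measurableSet_inWin _ _)

/-- The reciprocal of the measure of `winRect N p x`. -/
noncomputable def winScale {d : ℕ} (N : Fin d → ℕ) (p : Fin d → WinParam) : ℝ≥0∞ :=
  ∏ i, 2 ^ winLen (N i) (p i)

lemma winScale_mul_measure_le {d : ℕ} (N : Fin d → ℕ) (p : Fin d → WinParam) (t : Fin d → WG) :
    winScale N p * μD d {x | t ∈ winRect N p x} ≤ 1 := by
  have e : {x | t ∈ winRect N p x}
      = Set.pi Set.univ fun i => {y | InWin (N i) (p i) (y + t i)} := by
    ext x
    simp [winRect]
  rw [e, μD, Measure.pi_pi, winScale, ← Finset.prod_mul_distrib]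
  exact Finset.prod_le_one' fun i _ => two_pow_mul_μW_inWin_le _ _ _

end Windows

section KernelBounds

open Classical in
lemma ofReal_winKer {θ : ℝ} (hθ : 0 ≤ θ) (A : ℕ) (p : WinParam) (x : WG) :
    ENNReal.ofReal (winKer θ A p x) = (ENNReal.ofReal √θ ^ p.size) ^ 2 *
      (if InWin A p x then 2 ^ winLen A p else 0) := by
  rw [winKer, ENNReal.ofReal_mul (pow_nonneg hθ _)]
  congr 1
  · rw [← pow_mul, mul_comm, pow_mul, ← ENNReal.ofReal_pow (Real.sqrt_nonneg _),
      Real.sq_sqrt hθ, ENNReal.ofReal_pow hθ]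
  · split_ifs
    · rw [ENNReal.ofReal_pow (by norm_num)]
      simp
    · simp

lemma sum_le_tsum_of_injOn {ι κ : Type*} {s : Finset ι} {e : ι → κ} (he : Set.InjOn e s)
    (F : κ → ℝ≥0∞) : ∑ i ∈ s, F (e i) ≤ ∑' k, F k := by
  classical
  rw [← Finset.sum_image (f := F) he]
  exact ENNReal.sum_le_tsum _

lemma KK_zero (α : ℝ) (x : WG) : KK α 0 x = 0 := by simp [KK_eq]

lemma ofReal_abs_KK_le {α : ℝ} (h0 : 0 < α) (h1 : α ≤ 1) {n : ℕ} (hn : n ≠ 0) (x : WG) :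
    ENNReal.ofReal |KK α n x|
      ≤ 6 * ∑' p, ENNReal.ofReal (winKer (1 + α / 2)⁻¹ (Nat.log 2 n) p x) := by
  set θ := (1 + α / 2)⁻¹ with hθ
  set A := Nat.log 2 n
  have hc := isConcaveSeq_cSum h0 h1
  have hθ2 : 1 / 2 ≤ θ := by
    rw [hθ, one_div]
    exact inv_anti₀ (by linarith) (by linarith)
  obtain ⟨p₀, p₁, p₂, i1, i2, hb⟩ := exists_abs_sum_kacz_le hc hθ2
    (fun j hj => cSum_two_pow_le h0 h1 hj) (Nat.pow_log_le_self 2 hn)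
    (Nat.lt_pow_succ_log_self one_lt_two n) x
  have hpos : 0 < cSum α (n + 1) := cSum_pos h0 (Nat.succ_pos n)
  set S := winKer θ A p₀ x + ∑ B ∈ range A, winKer θ A (p₁ B) x
    + ∑ b ∈ range A, winKer θ A (p₂ b) x with hS
  have hw : ∀ p, 0 ≤ winKer θ A p x := fun p => winKer_nonneg (by linarith) _ _ _
  have hS0 : 0 ≤ S := add_nonneg (add_nonneg (hw _) (Finset.sum_nonneg fun _ _ => hw _))
    (Finset.sum_nonneg fun _ _ => hw _)
  have hK : |KK α n x| ≤ 2 * S := by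
    rw [KK_eq, Abin_eq_cSum, abs_mul, abs_of_pos (inv_pos.2 hpos), inv_mul_le_iff₀ hpos]
    refine hb.trans ?_
    have hm : cSum α n ≤ cSum α (n + 1) := hc.mono (Nat.le_succ n)
    nlinarith
  set Z := ∑' p, ENNReal.ofReal (winKer θ A p x) with hZ
  calc ENNReal.ofReal |KK α n x| ≤ ENNReal.ofReal (2 * S) := ENNReal.ofReal_le_ofReal hK
    _ = 2 * ENNReal.ofReal S := by
        rw [ENNReal.ofReal_mul (by norm_num)]
        simp
    _ ≤ 2 * (Z + Z + Z) := by
        rw [hS, ENNReal.ofReal_add (add_nonneg (hw _) (Finset.sum_nonneg fun _ _ => hw _))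
          (Finset.sum_nonneg fun _ _ => hw _), ENNReal.ofReal_add (hw _)
          (Finset.sum_nonneg fun _ _ => hw _), ENNReal.ofReal_sum_of_nonneg fun _ _ => hw _,
          ENNReal.ofReal_sum_of_nonneg fun _ _ => hw _]
        gcongr
        · exact ENNReal.le_tsum p₀
        · exact sum_le_tsum_of_injOn i1 fun p => ENNReal.ofReal (winKer θ A p x)
        · exact sum_le_tsum_of_injOn i2 fun p => ENNReal.ofReal (winKer θ A p x)
    _ = 6 * Z := by ring

lemma prod_tsum_eq_tsum_prod {ι : Type*} : ∀ {d : ℕ} (F : Fin d → ι → ℝ≥0∞),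
    ∏ i, ∑' p, F i p = ∑' P : Fin d → ι, ∏ i, F i (P i)
  | 0, F => by simp
  | d + 1, F => by
    rw [Fin.prod_univ_succ, prod_tsum_eq_tsum_prod fun i => F i.succ,
      ← (Fin.consEquiv fun _ => ι).tsum_eq, ENNReal.tsum_prod', ← ENNReal.tsum_mul_right]
    refine tsum_congr fun p => ?_
    rw [← ENNReal.tsum_mul_left]
    refine tsum_congr fun P => ?_
    rw [Fin.prod_univ_succ]
    simp [Fin.consEquiv]

lemma tsum_pow_size_ne_top {η : ℝ≥0∞} (hη : η < 1) : ∑' p : WinParam, η ^ p.size ≠ ⊤ := by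
  have e : ∑' p : WinParam, η ^ p.size = (1 - η)⁻¹ ^ 4 := by
    simp only [WinParam.size, pow_add, ENNReal.tsum_prod', ENNReal.tsum_mul_left,
      ENNReal.tsum_mul_right, ENNReal.tsum_geometric]
    ring
  rw [e]
  exact ENNReal.pow_ne_top (ENNReal.inv_ne_top.2 (tsub_pos_of_lt hη).ne')

end KernelBounds

section Cone

lemma log_two_mul_two_pow {q : ℕ} (hq : q ≠ 0) (c : ℕ) :
    Nat.log 2 (q * 2 ^ c) = Nat.log 2 q + c := by
  induction c with
  | zero => simp
  | succ c ih => rw [pow_succ, ← mul_assoc, Nat.log_mul_base one_lt_two (by positivity), ih]; rfl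

variable {d : ℕ} [NeZero d] {γ : Fin d → ℝ → ℝ} {β : Fin d → ℝ}

lemma IsCRF.exists_doubling (hγ : IsCRF d γ) {j : Fin d} (hj : j ≠ 0) :
    ∃ C : ℝ, 0 ≤ C ∧ ∀ x : ℝ, 1 ≤ x → γ j (2 * x) ≤ C * γ j x := by
  obtain ⟨ζ, hζ, h⟩ := hγ.reg
  obtain ⟨c₁, c₂, -, hc₂, hreg⟩ := h j hj
  have hiter : ∀ k : ℕ, ∀ x : ℝ, 1 ≤ x → γ j (ζ ^ k * x) ≤ c₂ ^ k * γ j x := by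
    intro k x hx
    induction k with
    | zero => simp
    | succ k ih =>
      have h1 : 1 ≤ ζ ^ k * x := one_le_mul_of_one_le_of_one_le (one_le_pow₀ hζ.le) hx
      calc γ j (ζ ^ (k + 1) * x) = γ j (ζ * (ζ ^ k * x)) := by rw [pow_succ']; ring_nf
        _ ≤ c₂ * γ j (ζ ^ k * x) := (hreg _ h1).2
        _ ≤ c₂ * (c₂ ^ k * γ j x) := by gcongr
        _ = _ := by ring
  obtain ⟨k, hk⟩ := pow_unbounded_of_one_lt 2 hζ
  refine ⟨c₂ ^ k, by positivity, fun x hx => le_trans ?_ (hiter k x hx)⟩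
  have hkx : 2 * x ≤ ζ ^ k * x := by gcongr
  exact (hγ.strictMono j hj).monotoneOn (Set.mem_Ici.2 (by linarith))
    (Set.mem_Ici.2 (by linarith)) hkx

lemma IsCRF.exists_level (hγ : IsCRF d γ) (hβ : ∀ j : Fin d, j ≠ 0 → 1 ≤ β j) (j : Fin d) :
    ∃ (N : ℕ → ℕ) (c : ℕ), Monotone N ∧ ∀ n ∈ coneLike d γ β, n 0 ≠ 0 →
      n j ≠ 0 ∧ N (Nat.log 2 (n 0)) ≤ Nat.log 2 (n j) ∧
        Nat.log 2 (n j) ≤ N (Nat.log 2 (n 0)) + c := by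
  by_cases hj : j = 0
  · subst hj
    exact ⟨id, 0, monotone_id, fun n _ h => ⟨h, le_rfl, le_rfl⟩⟩
  obtain ⟨C, hC0, hC⟩ := hγ.exists_doubling hj
  have hβj := hβ j hj
  have hβ0 : 0 < β j := by linarith
  obtain ⟨c, hc⟩ := pow_unbounded_of_one_lt (β j * C * β j) (one_lt_two)
  have hmono := (hγ.strictMono j hj).monotoneOn
  have one_le : ∀ a : ℕ, (1 : ℝ) ≤ 2 ^ a := fun a => one_le_pow₀ one_le_two
  refine ⟨fun a => Nat.log 2 ⌈(β j)⁻¹ * γ j (2 ^ a)⌉₊, c, fun a b hab => ?_, fun n hn h0 => ?_⟩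
  · refine Nat.log_mono_right (Nat.ceil_mono ?_)
    gcongr
    exact hmono (one_le a) (one_le b) (pow_le_pow_right₀ one_le_two hab)
  set a := Nat.log 2 (n 0) with ha
  obtain ⟨hl, hu⟩ := hn j hj
  have h1 : (2 : ℝ) ^ a ≤ n 0 := by exact_mod_cast Nat.pow_log_le_self 2 h0
  have h2 : (n 0 : ℝ) ≤ 2 * 2 ^ a := by
    rw [← pow_succ']
    exact_mod_cast (Nat.lt_pow_succ_log_self one_lt_two (n 0)).le
  have h3 : (1 : ℝ) ≤ n 0 := (one_le a).trans h1
  have hγ1 : γ j (2 ^ a) ≤ γ j (n 0) := hmono (one_le a) h3 h1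
  have hγ2 : γ j (n 0) ≤ C * γ j (2 ^ a) :=
    (hmono h3 (Set.mem_Ici.2 (by linarith [one_le a])) h2).trans (hC _ (one_le a))
  have hγpos : 0 < γ j (2 ^ a) := by linarith [hγ.one_le j hj _ (one_le a)]
  set q := ⌈(β j)⁻¹ * γ j (2 ^ a)⌉₊ with hq
  have hqpos : 0 < q := Nat.ceil_pos.2 (by positivity)
  have hqn : q ≤ n j := by
    refine Nat.ceil_le.2 (le_trans ?_ hl)
    gcongr
  refine ⟨(hqpos.trans_le hqn).ne', Nat.log_mono_right hqn, ?_⟩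
  have hq2 : γ j (2 ^ a) ≤ β j * q := by
    have := Nat.le_ceil ((β j)⁻¹ * γ j (2 ^ a))
    rwa [inv_mul_le_iff₀ hβ0] at this
  have hnq : n j ≤ q * 2 ^ c := by
    have : (n j : ℝ) ≤ q * 2 ^ c := by
      calc (n j : ℝ) ≤ β j * γ j (n 0) := hu
        _ ≤ β j * (C * (β j * q)) := by
          gcongr
          exact hγ2.trans (by gcongr)
        _ = q * (β j * C * β j) := by ring
        _ ≤ q * 2 ^ c := by gcongr
    exact_mod_cast this
  calc Nat.log 2 (n j) ≤ Nat.log 2 (q * 2 ^ c) := Nat.log_mono_right hnq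
    _ = Nat.log 2 q + c := log_two_mul_two_pow hqpos.ne' c

/-- The orders of the indices in a cone-like set stay within bounded distance of a chain. -/
lemma IsCRF.exists_chain (hγ : IsCRF d γ) (hβ : ∀ j : Fin d, j ≠ 0 → 1 ≤ β j) :
    ∃ (N : ℕ → Fin d → ℕ) (c : ℕ), Monotone N ∧ ∀ n ∈ coneLike d γ β, n 0 ≠ 0 →
      ∃ a, ∀ j, n j ≠ 0 ∧ N a j ≤ Nat.log 2 (n j) ∧ Nat.log 2 (n j) ≤ N a j + c := by
  choose N c hN h using fun j => hγ.exists_level hβ j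
  refine ⟨fun a j => N j a, ∑ j, c j, fun a b hab j => hN j hab, fun n hn h0 =>
    ⟨Nat.log 2 (n 0), fun j => ?_⟩⟩
  obtain ⟨h1, h2, h3⟩ := h j n hn h0
  exact ⟨h1, h2, h3.trans (Nat.add_le_add_left (single_le_sum (fun _ _ => Nat.zero_le _)
    (mem_univ j)) _)⟩

end Cone

section Convolution

variable {d : ℕ}

lemma measurable_rad (k : ℕ) : Measurable (rad k) := by
  have h : rad k = (fun a : ZMod 2 => (-1 : ℝ) ^ a.val) ∘ fun x => x k := rfl
  rw [h]
  exact (measurable_of_countable _).comp (measurable_coord k)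

lemma measurable_kacz (n : ℕ) : Measurable (kacz n) := by
  have h : kacz n = fun x => if n = 0 then 1 else rad (Nat.log 2 n) x *
      ∏ k ∈ range (Nat.log 2 n),
        (if n.testBit k then rad (Nat.log 2 n - 1 - k) x else 1) := by
    funext x
    unfold kacz
    congr 2
    rw [← prod_pow_eq_pow_sum]
    refine prod_congr rfl fun k _ => ?_
    split_ifs <;> simp [rad]
  rw [h]
  split_ifs
  · exact measurable_const
  · refine (measurable_rad _).mul (Finset.measurable_prod _ fun k _ => ?_)
    split_ifs
    · exact measurable_rad _
    · exact measurable_const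

lemma measurable_kaczD (m : Fin d → ℕ) : Measurable (kaczD d m) :=
  Finset.measurable_prod _ fun i _ => (measurable_kacz _).comp (measurable_pi_apply i)

lemma abs_kaczD (m : Fin d → ℕ) (x : Fin d → WG) : |kaczD d m x| = 1 := by
  rw [kaczD, Finset.abs_prod]
  exact prod_eq_one fun i _ => abs_kacz _ _

lemma kaczD_add (m : Fin d → ℕ) (x y : Fin d → WG) :
    kaczD d m (x + y) = kaczD d m x * kaczD d m y := by
  simp only [kaczD, ← Finset.prod_mul_distrib]
  exact prod_congr rfl fun i _ => kacz_add _ _ _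

lemma integrable_mul_kaczD {f : (Fin d → WG) → ℝ} (hf : Integrable f (μD d)) (m : Fin d → ℕ) :
    Integrable (fun x => f x * kaczD d m x) (μD d) :=
  hf.mul_bdd (c := 1) (measurable_kaczD m).aestronglyMeasurable
    (ae_of_all _ fun x => by rw [Real.norm_eq_abs, abs_kaczD])

lemma partialSumOf_eq_integral {f : (Fin d → WG) → ℝ} (hf : Integrable f (μD d))
    (k : Fin d → ℕ) (x : Fin d → WG) :
    partialSumOf d (fCoeff d f) k x = ∫ t, f t * ∏ i, dirK (k i) (x i + t i) ∂μD d := by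
  have h : ∀ t, f t * ∏ i, dirK (k i) (x i + t i)
      = ∑ m ∈ Fintype.piFinset (fun i => range (k i)), f t * kaczD d m t * kaczD d m x := by
    intro t
    simp only [dirK]
    rw [Finset.prod_univ_sum, Finset.mul_sum]
    refine sum_congr rfl fun m _ => ?_
    have := kaczD_add m x t
    simp only [kaczD, Pi.add_apply] at this ⊢
    rw [this]
    ring
  simp only [h]
  rw [integral_finsetSum _ fun m _ => (integrable_mul_kaczD hf m).mul_const _]
  exact sum_congr rfl fun m _ => (integral_mul_const _ _).symm

lemma integrable_mul_prod_dirK {f : (Fin d → WG) → ℝ} (hf : Integrable f (μD d))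
    (k : Fin d → ℕ) (x : Fin d → WG) :
    Integrable (fun t => f t * ∏ i, dirK (k i) (x i + t i)) (μD d) := by
  have hm : ∀ n, Measurable (dirK n) := fun n =>
    Finset.measurable_sum _ fun k _ => measurable_kacz k
  refine hf.mul_bdd (c := ∏ i, (k i : ℝ)) (Measurable.aestronglyMeasurable ?_)
    (ae_of_all _ fun t => ?_)
  · refine Finset.measurable_prod _ fun i _ => (hm _).comp ?_
    fun_prop
  · rw [norm_prod]
    refine prod_le_prod (fun _ _ => norm_nonneg _) fun i _ => ?_
    refine (norm_sum_le _ _).trans ?_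
    simp [abs_kacz]

/-- The Cesàro means are convolutions with products of one-dimensional kernels. -/
lemma cesaroOf_eq_integral (α : Fin d → ℝ) {f : (Fin d → WG) → ℝ} (hf : Integrable f (μD d))
    (n : Fin d → ℕ) (x : Fin d → WG) :
    cesaroOf d α (fCoeff d f) n x = ∫ t, f t * ∏ i, KK (α i) (n i) (x i + t i) ∂μD d := by
  have h : ∀ t, f t * ∏ i, KK (α i) (n i) (x i + t i)
      = (∏ i, Abin (α i) (n i))⁻¹ * ∑ k ∈ Fintype.piFinset (fun i => range (n i + 1)),
        (∏ i, Abin (α i - 1) (n i - k i)) * (f t * ∏ i, dirK (k i) (x i + t i)) := by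
    intro t
    simp only [KK]
    rw [Finset.prod_mul_distrib, Finset.prod_univ_sum, Finset.prod_inv_distrib, mul_left_comm,
      Finset.mul_sum]
    congr 1
    refine sum_congr rfl fun k _ => ?_
    rw [Finset.prod_mul_distrib]
    ring
  simp only [h]
  rw [integral_const_mul, integral_finsetSum _ fun k _ =>
    (integrable_mul_prod_dirK hf k x).const_mul _, cesaroOf]
  congr 1
  refine sum_congr rfl fun k _ => ?_
  rw [partialSumOf_eq_integral hf, integral_const_mul]

lemma ofReal_abs_cesaroOf_le (α : Fin d → ℝ) {f : (Fin d → WG) → ℝ} (hf : Integrable f (μD d))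
    (n : Fin d → ℕ) (x : Fin d → WG) :
    ENNReal.ofReal |cesaroOf d α (fCoeff d f) n x|
      ≤ ∫⁻ t, ENNReal.ofReal |f t| * ∏ i, ENNReal.ofReal |KK (α i) (n i) (x i + t i)| ∂μD d := by
  rw [cesaroOf_eq_integral α hf, ← Real.norm_eq_abs, ofReal_norm]
  refine (enorm_integral_le_lintegral_enorm _).trans (lintegral_mono fun t => ?_)
  rw [← ofReal_norm, norm_mul, norm_prod, ENNReal.ofReal_mul (norm_nonneg _),
    ENNReal.ofReal_prod_of_nonneg fun _ _ => norm_nonneg _]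
  simp only [Real.norm_eq_abs, le_refl]

end Convolution

section Majorant

variable {d : ℕ}

/-- The maximal operator along a chain of windows of a fixed shape. -/
noncomputable def winMaximal (N : ℕ → Fin d → ℕ) (p : Fin d → WinParam)
    (g : (Fin d → WG) → ℝ≥0∞) (x : Fin d → WG) : ℝ≥0∞ :=
  ⨆ a, winScale (N a) p * ∫⁻ t in winRect (N a) p x, g t ∂μD d

/-- A superposition of the operators `winMaximal` over all window shapes. -/
noncomputable def winMajorant (D : ℝ≥0∞) (H : (Fin d → WinParam) → ℝ≥0∞) (N : ℕ → Fin d → ℕ)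
    (g : (Fin d → WG) → ℝ≥0∞) (x : Fin d → WG) : ℝ≥0∞ :=
  D * ∑' p, H p ^ 2 * winMaximal N p g x

variable {N : ℕ → Fin d → ℕ} {g h : (Fin d → WG) → ℝ≥0∞} {D : ℝ≥0∞}
  {H : (Fin d → WinParam) → ℝ≥0∞}

lemma measurable_winMaximal (p : Fin d → WinParam) (hg : Measurable g) :
    Measurable (winMaximal N p g) :=
  Measurable.iSup fun a =>
    (measurable_setLIntegral_section (measurableSet_winRect (N a) p) hg).const_mul _

lemma measurable_winMajorant (hg : Measurable g) : Measurable (winMajorant D H N g) :=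
  (Measurable.tsum fun p => (measurable_winMaximal p hg).const_mul _).const_mul _

lemma mul_measure_winMaximal_le (hN : Monotone N) (p : Fin d → WinParam) (hg : Measurable g)
    (lam : ℝ≥0∞) : lam * μD d {x | lam < winMaximal N p g x} ≤ ∫⁻ t, g t ∂μD d :=
  weak_type_of_nested (R := fun a => winRect (N a) p) (κ := fun a => winScale (N a) p)
    (fun a => measurableSet_winRect (N a) p) (fun a => winScale_mul_measure_le (N a) p)
    (fun _ _ hab => winRect_antitone (hN hab) p) (fun _ _ _ _ => winRect_eq_of_mem) hg lam

lemma mul_measure_winMajorant_le (hN : Monotone N) (hD0 : D ≠ 0) (hD : D ≠ ⊤)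
    (hH0 : ∀ p, H p ≠ 0) (hH : ∑' p, H p ≠ ⊤) (hg : Measurable g) (lam : ℝ≥0∞) :
    lam * μD d {x | lam < winMajorant D H N g x} ≤ D * (∑' p, H p) ^ 2 * ∫⁻ t, g t ∂μD d := by
  have e : {x | lam < winMajorant D H N g x}
      = {x | lam / D < ∑' p, H p ^ 2 * winMaximal N p g x} := by
    ext x
    change lam < D * ∑' p, H p ^ 2 * winMaximal N p g x ↔
      lam / D < ∑' p, H p ^ 2 * winMaximal N p g x
    rw [mul_comm, ENNReal.div_lt_iff (Or.inl hD0) (Or.inl hD)]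
  have hw := weak_type_tsum hH hH0 (fun p lam => mul_measure_winMaximal_le hN p hg lam) (lam / D)
  rw [e]
  calc _ = D * (lam / D * μD d {x | lam / D < ∑' p, H p ^ 2 * winMaximal N p g x}) := by
        rw [← mul_assoc, ENNReal.mul_div_cancel hD0 hD]
    _ ≤ _ := by
        rw [mul_assoc]
        gcongr

lemma winScale_mul_measure_winRect_le (N : Fin d → ℕ) (p : Fin d → WinParam) (x : Fin d → WG) :
    winScale N p * μD d (winRect N p x) ≤ 1 := by
  have e : winRect N p x = {t | x ∈ winRect N p t} := by
    ext t
    change (∀ i, InWin (N i) (p i) (x i + t i)) ↔ ∀ i, InWin (N i) (p i) (t i + x i)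
    simp only [add_comm]
  rw [e]
  exact winScale_mul_measure_le N p x

lemma winMaximal_le_essSup (p : Fin d → WinParam) (g : (Fin d → WG) → ℝ≥0∞) (x : Fin d → WG) :
    winMaximal N p g x ≤ essSup g (μD d) := by
  refine iSup_le fun a => ?_
  calc winScale (N a) p * ∫⁻ t in winRect (N a) p x, g t ∂μD d
      ≤ winScale (N a) p * ∫⁻ _ in winRect (N a) p x, essSup g (μD d) ∂μD d := by
        exact mul_le_mul_right
          (lintegral_mono_ae (ae_restrict_of_ae (ENNReal.ae_le_essSup g))) _
    _ = winScale (N a) p * μD d (winRect (N a) p x) * essSup g (μD d) := by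
        rw [setLIntegral_const]
        ring
    _ ≤ essSup g (μD d) := mul_le_of_le_one_left' (winScale_mul_measure_winRect_le _ _ _)

lemma winMajorant_le_essSup (g : (Fin d → WG) → ℝ≥0∞) (x : Fin d → WG) :
    winMajorant D H N g x ≤ D * (∑' p, H p ^ 2) * essSup g (μD d) := by
  rw [winMajorant, mul_assoc, ← ENNReal.tsum_mul_right]
  gcongr with p
  exact winMaximal_le_essSup p g x

lemma winMaximal_le_add_const (p : Fin d → WinParam) (hh : Measurable h) {c : ℝ≥0∞}
    (hg : ∀ t, g t ≤ h t + c) (x : Fin d → WG) :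
    winMaximal N p g x ≤ winMaximal N p h x + c := by
  refine iSup_le fun a => ?_
  calc winScale (N a) p * ∫⁻ t in winRect (N a) p x, g t ∂μD d
      ≤ winScale (N a) p * ∫⁻ t in winRect (N a) p x, (h t + c) ∂μD d := by
        gcongr with t
        exact hg t
    _ = winScale (N a) p * ∫⁻ t in winRect (N a) p x, h t ∂μD d
        + winScale (N a) p * μD d (winRect (N a) p x) * c := by
        rw [lintegral_add_left hh, setLIntegral_const]
        ring
    _ ≤ winMaximal N p h x + c := by
        gcongr
        · exact le_iSup (fun a => winScale (N a) p * ∫⁻ t in winRect (N a) p x, h t ∂μD d) a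
        · exact mul_le_of_le_one_left' (winScale_mul_measure_winRect_le _ _ _)

lemma winMajorant_le_add_const (hh : Measurable h) {c : ℝ≥0∞}
    (hg : ∀ t, g t ≤ h t + c) (x : Fin d → WG) :
    winMajorant D H N g x ≤ winMajorant D H N h x + D * (∑' p, H p ^ 2) * c := by
  rw [winMajorant, winMajorant, mul_assoc, ← mul_add, ← ENNReal.tsum_mul_right,
    ← ENNReal.tsum_add]
  gcongr with p
  rw [← mul_add]
  gcongr
  exact winMaximal_le_add_const p hh hg x

/-- The strong type inequalities for `winMajorant`. -/
lemma exists_lintegral_winMajorant_rpow_le (hN : Monotone N) (hD0 : D ≠ 0) (hD : D ≠ ⊤)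
    (hH0 : ∀ p, H p ≠ 0) (hH : ∑' p, H p ≠ ⊤) (hH2 : ∑' p, H p ^ 2 ≠ ⊤) {p : ℝ} (hp : 1 < p) :
    ∃ C : ℝ≥0∞, C ≠ ⊤ ∧ ∀ f : (Fin d → WG) → ℝ, Measurable f → Integrable f (μD d) →
      ∫⁻ x, winMajorant D H N (fun t => ENNReal.ofReal |f t|) x ^ p ∂μD d
        ≤ C * ∫⁻ x, ENNReal.ofReal |f x| ^ p ∂μD d := by
  set B := (D * ∑' p, H p ^ 2).toReal + 1 with hB
  have hB0 : 0 < B := by positivity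
  have hBle : D * ∑' p, H p ^ 2 ≤ ENNReal.ofReal B := by
    rw [← ENNReal.ofReal_toReal (ENNReal.mul_ne_top hD hH2)]
    exact ENNReal.ofReal_le_ofReal (by linarith)
  set W := 2 * (D * (∑' p, H p) ^ 2) with hW
  have hWt : W ≠ ⊤ :=
    ENNReal.mul_ne_top ofNat_ne_top (ENNReal.mul_ne_top hD (ENNReal.pow_ne_top hH))
  refine ⟨ENNReal.ofReal p * W * ENNReal.ofReal ((2 * B) ^ (p - 1) / (p - 1)),
    ENNReal.mul_ne_top (ENNReal.mul_ne_top ENNReal.ofReal_ne_top hWt) ENNReal.ofReal_ne_top,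
    fun f hf hfi => ?_⟩
  have hfa : Measurable fun x => |f x| := by fun_prop
  refine lintegral_rpow_le_of_weak_type (measurable_winMajorant hfa.ennreal_ofReal) hfa
    (fun _ => abs_nonneg _) ?_ hWt (K := 2 * B) (by positivity) (fun t ht => ?_) hp
  · have := hfi.abs.lintegral_lt_top
    exact this.ne
  set S := {x | t < 2 * B * |f x|} with hS
  have hSm : MeasurableSet S := measurableSet_lt measurable_const (hfa.const_mul _)
  have hh : Measurable (S.indicator fun x => ENNReal.ofReal |f x|) :=
    hfa.ennreal_ofReal.indicator hSm
  have hle : ∀ x, ENNReal.ofReal |f x|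
      ≤ S.indicator (fun x => ENNReal.ofReal |f x|) x + ENNReal.ofReal (t / (2 * B)) := by
    intro x
    by_cases hx : x ∈ S
    · rw [Set.indicator_of_mem hx]
      exact le_self_add
    · rw [Set.indicator_of_notMem hx, zero_add]
      refine ENNReal.ofReal_le_ofReal ?_
      rw [le_div_iff₀ (by positivity), mul_comm]
      exact not_lt.1 hx
  have hsub : {x | ENNReal.ofReal t < winMajorant D H N (fun t => ENNReal.ofReal |f t|) x}
      ⊆ {x | ENNReal.ofReal (t / 2)
        < winMajorant D H N (S.indicator fun t => ENNReal.ofReal |f t|) x} := by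
    intro x hx
    have hx' : ENNReal.ofReal t < winMajorant D H N (fun t => ENNReal.ofReal |f t|) x := hx
    by_contra hcon
    have h1 : winMajorant D H N (S.indicator fun t => ENNReal.ofReal |f t|) x
        ≤ ENNReal.ofReal (t / 2) := not_lt.1 hcon
    refine absurd hx' (not_lt.2 ?_)
    calc winMajorant D H N (fun t => ENNReal.ofReal |f t|) x
        ≤ winMajorant D H N (S.indicator fun t => ENNReal.ofReal |f t|) x
          + D * (∑' p, H p ^ 2) * ENNReal.ofReal (t / (2 * B)) :=
          winMajorant_le_add_const hh hle x
      _ ≤ ENNReal.ofReal (t / 2) + ENNReal.ofReal B * ENNReal.ofReal (t / (2 * B)) := by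
          gcongr
      _ = ENNReal.ofReal t := by
          rw [← ENNReal.ofReal_mul hB0.le, ← ENNReal.ofReal_add (by positivity) (by positivity)]
          congr 1
          field_simp
          ring
  calc ENNReal.ofReal t
        * μD d {x | ENNReal.ofReal t < winMajorant D H N (fun t => ENNReal.ofReal |f t|) x}
      ≤ 2 * ENNReal.ofReal (t / 2) * μD d {x | ENNReal.ofReal (t / 2)
        < winMajorant D H N (S.indicator fun t => ENNReal.ofReal |f t|) x} := by
        refine mul_le_mul' (le_of_eq ?_) (measure_mono hsub)
        rw [← ENNReal.ofReal_ofNat 2, ← ENNReal.ofReal_mul (by norm_num)]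
        congr 1
        ring
    _ ≤ 2 * (D * (∑' p, H p) ^ 2 * ∫⁻ x, S.indicator (fun t => ENNReal.ofReal |f t|) x ∂μD d) := by
        rw [mul_assoc]
        exact mul_le_mul_right (mul_measure_winMajorant_le hN hD0 hD hH0 hH hh _) _
    _ = W * ∫⁻ x in S, ENNReal.ofReal |f x| ∂μD d := by
        rw [lintegral_indicator hSm, ← mul_assoc]

end Majorant

section Domination

variable {d : ℕ}

/-- The square root of the decay rate of the `(C,α)` kernel across window shapes. -/
noncomputable def decayRate (α : ℝ) : ℝ≥0∞ := ENNReal.ofReal √(1 + α / 2)⁻¹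

lemma decayRate_ne_zero {α : ℝ} (h0 : 0 < α) : decayRate α ≠ 0 := by
  rw [decayRate, ne_eq, ENNReal.ofReal_eq_zero, not_le]
  positivity

lemma decayRate_lt_one {α : ℝ} (h0 : 0 < α) : decayRate α < 1 := by
  rw [decayRate, ENNReal.ofReal_lt_one, Real.sqrt_lt' one_pos, one_pow]
  exact inv_lt_one_of_one_lt₀ (by linarith)

/-- The square root of the weight of a family of window shapes. -/
noncomputable def winWeight (α : Fin d → ℝ) (p : Fin d → WinParam) : ℝ≥0∞ :=
  ∏ i, decayRate (α i) ^ (p i).size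

lemma winWeight_ne_zero {α : Fin d → ℝ} (h0 : ∀ i, 0 < α i) (p : Fin d → WinParam) :
    winWeight α p ≠ 0 :=
  prod_ne_zero_iff.2 fun i _ => pow_ne_zero _ (decayRate_ne_zero (h0 i))

lemma tsum_winWeight_ne_top {α : Fin d → ℝ} (h0 : ∀ i, 0 < α i) : ∑' p, winWeight α p ≠ ⊤ := by
  simp only [winWeight]
  rw [← prod_tsum_eq_tsum_prod fun i (p : WinParam) => decayRate (α i) ^ p.size]
  exact ENNReal.prod_ne_top fun i _ => tsum_pow_size_ne_top (decayRate_lt_one (h0 i))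

lemma winWeight_le_one {α : Fin d → ℝ} (h0 : ∀ i, 0 < α i) (p : Fin d → WinParam) :
    winWeight α p ≤ 1 :=
  Finset.prod_le_one' fun i _ => pow_le_one' (decayRate_lt_one (h0 i)).le _

lemma tsum_winWeight_sq_ne_top {α : Fin d → ℝ} (h0 : ∀ i, 0 < α i) :
    ∑' p, winWeight α p ^ 2 ≠ ⊤ := by
  refine ne_top_of_le_ne_top (tsum_winWeight_ne_top h0) (ENNReal.tsum_le_tsum fun p => ?_)
  rw [sq]
  exact mul_le_of_le_one_right' (winWeight_le_one h0 p)

open Classical in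
lemma ofReal_winKer_le {α : ℝ} (h0 : 0 < α) {A B c : ℕ} (h1 : B ≤ A) (h2 : A ≤ B + c)
    (p : WinParam) (x : WG) :
    ENNReal.ofReal (winKer (1 + α / 2)⁻¹ A p x) ≤ 2 ^ c * ((decayRate α ^ p.size) ^ 2 *
      (if InWin B p x then 2 ^ winLen B p else 0)) := by
  rw [ofReal_winKer (by positivity), mul_left_comm]
  refine mul_le_mul_right ?_ _
  split_ifs with hA hB hB
  · rw [← pow_add]
    refine pow_le_pow_right₀ one_le_two ?_
    simp only [winLen]
    omega
  · exact absurd (hA.mono h1) hB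
  · exact zero_le
  · exact zero_le

open Classical in
lemma prod_ofReal_abs_KK_le {α : Fin d → ℝ} (h0 : ∀ i, 0 < α i) (h1 : ∀ i, α i ≤ 1)
    {n M : Fin d → ℕ} {c : ℕ} (hn : ∀ i, n i ≠ 0) (hM : ∀ i, M i ≤ Nat.log 2 (n i))
    (hM' : ∀ i, Nat.log 2 (n i) ≤ M i + c) (x t : Fin d → WG) :
    ∏ i, ENNReal.ofReal |KK (α i) (n i) (x i + t i)| ≤ (6 * 2 ^ c) ^ d *
      ∑' p, winWeight α p ^ 2 * (winScale M p * (winRect M p x).indicator 1 t) := by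
  calc ∏ i, ENNReal.ofReal |KK (α i) (n i) (x i + t i)|
      ≤ ∏ i, (6 * 2 ^ c * ∑' p : WinParam, ((decayRate (α i) ^ p.size) ^ 2 *
          (if InWin (M i) p (x i + t i) then 2 ^ winLen (M i) p else 0))) := by
        refine prod_le_prod' fun i _ => (ofReal_abs_KK_le (h0 i) (h1 i) (hn i) _).trans ?_
        rw [mul_assoc]
        refine mul_le_mul_right ?_ _
        rw [← ENNReal.tsum_mul_left]
        exact ENNReal.tsum_le_tsum fun p => ofReal_winKer_le (h0 i) (hM i) (hM' i) p _
    _ = _ := by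
        rw [Finset.prod_mul_distrib, prod_const, card_univ, Fintype.card_fin,
          prod_tsum_eq_tsum_prod]
        congr 1
        refine tsum_congr fun p => ?_
        rw [Finset.prod_mul_distrib, Finset.prod_pow, ← winWeight]
        congr 1
        by_cases ht : t ∈ winRect M p x
        · rw [Set.indicator_of_mem ht, Pi.one_apply, mul_one, winScale]
          exact prod_congr rfl fun i _ => if_pos (ht i)
        · rw [Set.indicator_of_notMem ht, mul_zero]
          obtain ⟨i, hi⟩ := not_forall.1 ht
          exact prod_eq_zero (mem_univ i) (if_neg hi)

lemma cesaroMaximal_le_winMajorant [NeZero d] {α : Fin d → ℝ} (h0 : ∀ i, 0 < α i)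
    (h1 : ∀ i, α i ≤ 1) {γ : Fin d → ℝ → ℝ} {β : Fin d → ℝ} {N : ℕ → Fin d → ℕ} {c : ℕ}
    (hN : ∀ n ∈ coneLike d γ β, n 0 ≠ 0 →
      ∃ a, ∀ j, n j ≠ 0 ∧ N a j ≤ Nat.log 2 (n j) ∧ Nat.log 2 (n j) ≤ N a j + c)
    {f : (Fin d → WG) → ℝ} (hf : Integrable f (μD d)) (x : Fin d → WG) :
    cesaroMaximal d α γ β (fCoeff d f) x
      ≤ winMajorant ((6 * 2 ^ c) ^ d) (winWeight α) N (fun t => ENNReal.ofReal |f t|) x := by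
  refine iSup₂_le fun n hn => (ofReal_abs_cesaroOf_le α hf n x).trans ?_
  by_cases hn0 : n 0 = 0
  · refine le_of_eq_of_le ?_ zero_le
    rw [lintegral_eq_zero_of_ae_eq_zero]
    refine ae_of_all _ fun t => ?_
    have hz : ∏ i, ENNReal.ofReal |KK (α i) (n i) (x i + t i)| = 0 :=
      prod_eq_zero (mem_univ 0) (by rw [hn0, KK_zero]; simp)
    simp [hz]
  obtain ⟨a, ha⟩ := hN n hn hn0
  have hg : AEMeasurable (fun t => ENNReal.ofReal |f t|) (μD d) :=
    hf.1.aemeasurable.abs.ennreal_ofReal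
  have hR : ∀ p, MeasurableSet (winRect (N a) p x) := fun p =>
    measurable_prodMk_left (measurableSet_winRect (N a) p)
  have hDt : ((6 * 2 ^ c) ^ d : ℝ≥0∞) ≠ ⊤ := by finiteness
  calc ∫⁻ t, ENNReal.ofReal |f t| * ∏ i, ENNReal.ofReal |KK (α i) (n i) (x i + t i)| ∂μD d
      ≤ ∫⁻ t, (6 * 2 ^ c) ^ d * ∑' p, winWeight α p ^ 2 * winScale (N a) p *
          (winRect (N a) p x).indicator (fun t => ENNReal.ofReal |f t|) t ∂μD d := by
        refine lintegral_mono fun t => ?_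
        refine (mul_le_mul_right (prod_ofReal_abs_KK_le h0 h1 (fun i => (ha i).1)
          (fun i => (ha i).2.1) (fun i => (ha i).2.2) x t) _).trans (le_of_eq ?_)
        rw [mul_left_comm, ← ENNReal.tsum_mul_left]
        congr 1
        refine tsum_congr fun p => ?_
        by_cases ht : t ∈ winRect (N a) p x
        · simp only [Set.indicator_of_mem ht, Pi.one_apply]
          ring
        · simp only [Set.indicator_of_notMem ht, mul_zero]
    _ = (6 * 2 ^ c) ^ d * ∑' p, winWeight α p ^ 2 * winScale (N a) p *
          ∫⁻ t in winRect (N a) p x, ENNReal.ofReal |f t| ∂μD d := by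
        rw [lintegral_const_mul' _ _ hDt, lintegral_tsum]
        · congr 1
          refine tsum_congr fun p => ?_
          rw [lintegral_const_mul'' _ (hg.indicator (hR p)), lintegral_indicator (hR p)]
        · exact fun p => (hg.indicator (hR p)).const_mul _
    _ ≤ _ := by
        refine mul_le_mul_right (ENNReal.tsum_le_tsum fun p => ?_) _
        rw [mul_assoc]
        exact mul_le_mul_right (le_iSup (fun a => winScale (N a) p *
          ∫⁻ t in winRect (N a) p x, ENNReal.ofReal |f t| ∂μD d) a) _

lemma fCoeff_congr {f g : (Fin d → WG) → ℝ} (h : f =ᵐ[μD d] g) : fCoeff d f = fCoeff d g := by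
  funext m
  exact integral_congr_ae (h.mono fun x hx => by simp only [hx])

lemma integrable_of_lintegral_rpow_ne_top {f : (Fin d → WG) → ℝ} (hf : Measurable f) {p : ℝ}
    (hp : 1 ≤ p) (h : ∫⁻ x, ENNReal.ofReal |f x| ^ p ∂μD d ≠ ⊤) : Integrable f (μD d) := by
  refine ⟨hf.aestronglyMeasurable, ?_⟩
  have hle : ∀ x, ‖f x‖ₑ ≤ 1 + ENNReal.ofReal |f x| ^ p := by
    intro x
    rw [← ofReal_norm, Real.norm_eq_abs]
    rcases le_total (ENNReal.ofReal |f x|) 1 with hx | hx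
    · exact hx.trans le_self_add
    · refine le_trans ?_ le_add_self
      simpa using ENNReal.rpow_le_rpow_of_exponent_le hx hp
  refine lt_of_le_of_lt (lintegral_mono hle) ?_
  rw [lintegral_add_left measurable_const, lintegral_one, measure_univ]
  exact ENNReal.add_lt_top.2 ⟨one_lt_top, lt_top_iff_ne_top.2 h⟩

end Domination

noncomputable section

/-- the cone-like restricted maximal operator `σ_L^{κ,α,*}` is of type
`(p,p)` for `1 < p ≤ ∞` (the case `p = ∞` is the second conjunct, via essential suprema)
and of weak type `(1,1)`. -/
theorem cesaroMaximal_type_pp_and_weak11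
    (d : ℕ) (α : Fin (d + 1) → ℝ) (hα : ∀ i, 0 < α i ∧ α i ≤ 1)
    (γ : Fin (d + 1) → ℝ → ℝ) (hγ : IsCRF (d + 1) γ)
    (β : Fin (d + 1) → ℝ) (hβ : ∀ j : Fin (d + 1), j ≠ 0 → 1 ≤ β j) :
    (∀ p : ℝ, 1 < p → ∃ C : ℝ≥0∞, C ≠ ⊤ ∧
      ∀ f : (Fin (d + 1) → WG) → ℝ, Measurable f →
        lpNormE (d + 1) p (fun x => ENNReal.ofReal |f x|) ≠ ⊤ →
        lpNormE (d + 1) p (cesaroMaximal (d + 1) α γ β (fCoeff (d + 1) f))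
          ≤ C * lpNormE (d + 1) p (fun x => ENNReal.ofReal |f x|)) ∧
    (∃ C : ℝ≥0∞, C ≠ ⊤ ∧
      ∀ f : (Fin (d + 1) → WG) → ℝ, Measurable f →
        essSup (cesaroMaximal (d + 1) α γ β (fCoeff (d + 1) f)) (μD (d + 1))
          ≤ C * essSup (fun x => ENNReal.ofReal |f x|) (μD (d + 1))) ∧
    (∃ c : ℝ, 0 < c ∧
      ∀ f : (Fin (d + 1) → WG) → ℝ, Integrable f (μD (d + 1)) →
        ∀ lam : ℝ, 0 < lam →
        μD (d + 1) {x | ENNReal.ofReal lam < cesaroMaximal (d + 1) α γ β (fCoeff (d + 1) f) x}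
          ≤ ENNReal.ofReal (c * (∫ x, |f x| ∂ μD (d + 1)) / lam)) := by
  obtain ⟨N, c, hNmono, hN⟩ := hγ.exists_chain hβ
  have h0 : ∀ i, 0 < α i := fun i => (hα i).1
  have hH0 := winWeight_ne_zero h0
  have hH := tsum_winWeight_ne_top h0
  have hH2 := tsum_winWeight_sq_ne_top h0
  set D : ℝ≥0∞ := (6 * 2 ^ c) ^ (d + 1) with hD
  have hD0 : D ≠ 0 := by positivity
  have hDt : D ≠ ⊤ := by finiteness
  have hdom : ∀ {f : (Fin (d + 1) → WG) → ℝ}, Integrable f (μD (d + 1)) → ∀ x,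
      cesaroMaximal (d + 1) α γ β (fCoeff (d + 1) f) x
        ≤ winMajorant D (winWeight α) N (fun t => ENNReal.ofReal |f t|) x :=
    fun hf x => cesaroMaximal_le_winMajorant h0 (fun i => (hα i).2) hN hf x
  refine ⟨fun p hp => ?_, ?_, ?_⟩
  · have hp0 : 0 < p := by linarith
    obtain ⟨C, hC, hle⟩ := exists_lintegral_winMajorant_rpow_le hNmono hD0 hDt hH0 hH hH2 hp
    refine ⟨C ^ (1 / p), ENNReal.rpow_ne_top_of_nonneg (by positivity) hC, fun f hf hfp => ?_⟩
    have hfp' : ∫⁻ x, ENNReal.ofReal |f x| ^ p ∂μD (d + 1) ≠ ⊤ := fun h => hfp <| by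
      rw [lpNormE, h, ENNReal.top_rpow_of_pos (by positivity)]
    have hfi := integrable_of_lintegral_rpow_ne_top hf hp.le hfp'
    rw [lpNormE, lpNormE, ← ENNReal.mul_rpow_of_nonneg _ _ (by positivity)]
    refine ENNReal.rpow_le_rpow (le_trans (lintegral_mono fun x => ?_) (hle f hf hfi))
      (by positivity)
    exact ENNReal.rpow_le_rpow (hdom hfi x) hp0.le
  · refine ⟨D * (∑' p, winWeight α p ^ 2) + 1, by finiteness, fun f hf => ?_⟩
    by_cases ht : essSup (fun x => ENNReal.ofReal |f x|) (μD (d + 1)) = ⊤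
    · rw [ht, ENNReal.mul_top (by positivity)]
      exact le_top
    have hfi : Integrable f (μD (d + 1)) := by
      refine integrable_of_lintegral_rpow_ne_top hf le_rfl (ne_top_of_le_ne_top ht ?_)
      simp only [ENNReal.rpow_one]
      refine (lintegral_mono_ae (ENNReal.ae_le_essSup _)).trans ?_
      rw [lintegral_const, measure_univ, mul_one]
    refine essSup_le_of_ae_le _ (ae_of_all _ fun x => ?_)
    refine ((hdom hfi x).trans (winMajorant_le_essSup _ x)).trans ?_
    exact mul_le_mul_left le_self_add _
  · set W := D * (∑' p, winWeight α p) ^ 2 with hW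
    have hWt : W ≠ ⊤ := by finiteness
    refine ⟨W.toReal + 1, by positivity, fun f hf lam hlam => ?_⟩
    set g := hf.1.mk f with hgdef
    have hgm : Measurable g := hf.1.measurable_mk
    have hfg : f =ᵐ[μD (d + 1)] g := hf.1.ae_eq_mk
    have hgi : Integrable g (μD (d + 1)) := hf.congr hfg
    have e : ∫ x, |f x| ∂μD (d + 1) = ∫ x, |g x| ∂μD (d + 1) :=
      integral_congr_ae (hfg.mono fun x hx => by simp only [hx])
    have hgl : ∫⁻ x, ENNReal.ofReal |g x| ∂μD (d + 1)
        = ENNReal.ofReal (∫ x, |g x| ∂μD (d + 1)) :=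
      (ofReal_integral_eq_lintegral_ofReal hgi.abs (ae_of_all _ fun _ => abs_nonneg _)).symm
    have hw := mul_measure_winMajorant_le hNmono hD0 hDt hH0 hH
      (show Measurable fun x => ENNReal.ofReal |g x| by fun_prop) (ENNReal.ofReal lam)
    have hWle : W ≤ ENNReal.ofReal (W.toReal + 1) := by
      conv_lhs => rw [← ENNReal.ofReal_toReal hWt]
      exact ENNReal.ofReal_le_ofReal (by linarith)
    rw [fCoeff_congr hfg, e, ENNReal.ofReal_div_of_pos hlam,
      ENNReal.le_div_iff_mul_le (Or.inl (by simpa using hlam)) (Or.inl ENNReal.ofReal_ne_top),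
      ENNReal.ofReal_mul (by positivity), mul_comm, ← hgl]
    refine le_trans ?_ (hw.trans (mul_le_mul_left hWle _))
    exact mul_le_mul_right (measure_mono fun x hx => lt_of_lt_of_le hx (hdom hgi x)) _

end
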